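/- arXiv:2502.19851 — 2 statements merged into one kernel-verified Lean document; each statement's English description precedes it below -/
import Mathlib

section
/- Let (X₁,Y₁),…,(Xₙ,Yₙ) be i.i.d. from P with Y ∈ [0,1], and let f: 𝒳 → [0,1] be a fixed measurable function. Let h_n: [0,1] → [0,1] denote the isotonic regression fit of the outcomes Y_i on the forecasts f(X_i), i.e., a monotone non-decreasing function minimizing Σ_{i=1}^n (Y_i − h(f(X_i)))² over monotone non-decreasing h: [0,1] → [0,1]. Then for any δ > 0, with probability at least 1 − δ: Δ_Cutoff^P(h_n ∘ f) ≤ (30 + 2√(2·log(2/δ)))/√n. -/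
open MeasureTheory Set

/-- Cutoff Calibration Error of `g` with respect to a joint distribution `P` of `(X,Y)`
on `𝒳 × ℝ`: supremum over intervals `I ⊆ [0,1]` of `|E_P[(Y − g(X))·1{g(X) ∈ I}]|`. -/
noncomputable def cutoffCEP {𝒳 : Type*} [MeasurableSpace 𝒳]
    (P : Measure (𝒳 × ℝ)) (g : 𝒳 → ℝ) : ℝ :=
  ⨆ I : {I : Set ℝ // I ⊆ Icc 0 1 ∧ I.OrdConnected},
    |∫ p, (p.2 - g p.1) * I.1.indicator (1 : ℝ → ℝ) (g p.1) ∂P|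

/-- If `h` cannot be improved in squared error by monotone post-processing, the residuals sum to at
most zero on each level set of `h`. -/
lemma sum_level_residual_nonpos {ι : Type*} [Fintype ι] (y h : ι → ℝ)
    (hy : ∀ i, y i ≤ 1) (hh : ∀ i, h i ∈ Icc (0:ℝ) 1)
    (hmin : ∀ φ : ℝ → ℝ, Monotone φ → (∀ t ∈ Icc (0:ℝ) 1, φ t ∈ Icc (0:ℝ) 1) →
      ∑ i, (y i - h i) ^ 2 ≤ ∑ i, (y i - φ (h i)) ^ 2) (c : ℝ) :
    ∑ i with h i = c, (y i - c) ≤ 0 := by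
  by_contra! hS
  obtain ⟨i₀, hi₀, hpos⟩ : ∃ i ∈ Finset.univ.filter (fun i => h i = c), 0 < y i - c := by
    by_contra! hneg
    exact hS.not_ge (Finset.sum_nonpos hneg)
  have hic : h i₀ = c := (Finset.mem_filter.1 hi₀).2
  have hc1 : c < 1 := by linarith [hy i₀]
  have hc0 : 0 ≤ c := hic ▸ (hh i₀).1
  set S := ∑ i with h i = c, (y i - c) with hSdef
  have ev1 : ∀ᶠ ε in nhdsWithin (0:ℝ) (Ioi 0), c + ε < 1 :=
    nhdsWithin_le_nhds (((by fun_prop : Continuous fun ε : ℝ => c + ε).tendsto 0).eventually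
      (gt_mem_nhds (by simpa using hc1)))
  have ev2 : ∀ᶠ ε in nhdsWithin (0:ℝ) (Ioi 0), ∀ i, c < h i → c + ε < h i := by
    rw [Filter.eventually_all]
    intro i
    by_cases hi : c < h i
    · filter_upwards [nhdsWithin_le_nhds (((by fun_prop :
        Continuous fun ε : ℝ => c + ε).tendsto 0).eventually
        (gt_mem_nhds (show c + 0 < h i by simpa using hi)))] with ε hε _ using hε
    · exact Filter.Eventually.of_forall fun _ h' => absurd h' hi
  have ev3 : ∀ᶠ ε in nhdsWithin (0:ℝ) (Ioi 0),
      ((Finset.univ.filter fun i => h i = c).card : ℝ) * ε < S :=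
    nhdsWithin_le_nhds (((by fun_prop : Continuous fun ε : ℝ =>
      ((Finset.univ.filter fun i => h i = c).card : ℝ) * ε).tendsto 0).eventually
      (gt_mem_nhds (by simpa using hS)))
  obtain ⟨ε, ⟨⟨e1, e2⟩, e3⟩, e0⟩ := (((ev1.and ev2).and ev3).and self_mem_nhdsWithin).exists
  have key := hmin (fun t => if t < c then t else max t (c + ε)) (by
      intro s t hst
      dsimp only
      split_ifs with h1 h2 h2
      · exact hst
      · exact le_max_of_le_left hst
      · linarith
      · exact max_le_max_right _ hst) (by
      intro t ht
      split_ifs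
      · exact ht
      · exact ⟨le_max_of_le_left ht.1, max_le ht.2 e1.le⟩)
  have heq : ∀ i, (y i - (if h i < c then h i else max (h i) (c + ε))) ^ 2
      = (y i - h i) ^ 2 + if h i = c then ε ^ 2 - 2 * ε * (y i - c) else 0 := by
    intro i
    rcases lt_trichotomy (h i) c with hlt | he | hgt
    · simp [hlt, hlt.ne]
    · simp only [he, lt_irrefl, if_false, if_true]
      rw [max_eq_right (by linarith)]
      ring
    · simp [hgt.not_gt, hgt.ne', max_eq_left (e2 i hgt).le]
  simp_rw [heq, Finset.sum_add_distrib, ← Finset.sum_filter, Finset.sum_sub_distrib,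
    ← Finset.mul_sum, Finset.sum_const, nsmul_eq_mul] at key
  rw [← hSdef] at key
  nlinarith

lemma sum_level_residual_eq_zero {ι : Type*} [Fintype ι] (y h : ι → ℝ)
    (hy : ∀ i, y i ∈ Icc (0:ℝ) 1) (hh : ∀ i, h i ∈ Icc (0:ℝ) 1)
    (hmin : ∀ φ : ℝ → ℝ, Monotone φ → (∀ t ∈ Icc (0:ℝ) 1, φ t ∈ Icc (0:ℝ) 1) →
      ∑ i, (y i - h i) ^ 2 ≤ ∑ i, (y i - φ (h i)) ^ 2) (c : ℝ) :
    ∑ i with h i = c, (y i - c) = 0 := by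
  refine le_antisymm (sum_level_residual_nonpos y h (fun i => (hy i).2) hh hmin c) ?_
  have h1 := sum_level_residual_nonpos (fun i => 1 - y i) (fun i => 1 - h i)
    (fun i => by linarith [(hy i).1])
    (fun i => ⟨by linarith [(hh i).2], by linarith [(hh i).1]⟩) (by
      intro φ hφ hφ01
      have h2 := hmin (fun t => 1 - φ (1 - t))
        (fun s t hst => by have := hφ (show 1 - t ≤ 1 - s by linarith); dsimp only; linarith)
        (fun t ht => by
          have := hφ01 (1 - t) ⟨by linarith [ht.2], by linarith [ht.1]⟩
          exact ⟨by linarith [this.2], by linarith [this.1]⟩)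
      calc ∑ i, (1 - y i - (1 - h i)) ^ 2 = ∑ i, (y i - h i) ^ 2 :=
            Finset.sum_congr rfl fun i _ => by ring
        _ ≤ _ := h2
        _ = _ := Finset.sum_congr rfl fun i _ => by ring) (1 - c)
  have h3 : ∑ i with 1 - h i = 1 - c, (1 - y i - (1 - c)) = -∑ i with h i = c, (y i - c) := by
    rw [← Finset.sum_neg_distrib]
    exact Finset.sum_congr (by ext i; simp) fun i _ => by ring
  linarith

lemma sum_residual_indicator_eq_zero {ι : Type*} [Fintype ι] (y h : ι → ℝ)
    (hy : ∀ i, y i ∈ Icc (0:ℝ) 1) (hh : ∀ i, h i ∈ Icc (0:ℝ) 1)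
    (hmin : ∀ φ : ℝ → ℝ, Monotone φ → (∀ t ∈ Icc (0:ℝ) 1, φ t ∈ Icc (0:ℝ) 1) →
      ∑ i, (y i - h i) ^ 2 ≤ ∑ i, (y i - φ (h i)) ^ 2) (I : Set ℝ) :
    ∑ i, (y i - h i) * I.indicator (1 : ℝ → ℝ) (h i) = 0 := by
  classical
  rw [← Finset.sum_fiberwise_of_maps_to (t := Finset.univ.image h)
    (fun i _ => Finset.mem_image_of_mem h (Finset.mem_univ i))]
  refine Finset.sum_eq_zero fun c _ => ?_
  rw [Finset.sum_congr rfl (g := fun i => (y i - c) * I.indicator (1 : ℝ → ℝ) c)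
    (fun i hi => by rw [(Finset.mem_filter.1 hi).2]), ← Finset.sum_mul,
    sum_level_residual_eq_zero y h hy hh hmin c, zero_mul]

/-- The Rademacher sign attached to a Boolean. -/
def boolSign (b : Bool) : ℝ := if b then 1 else -1

lemma boolSign_sq (b : Bool) : boolSign b ^ 2 = 1 := by cases b <;> simp [boolSign]

lemma boolSign_not (b : Bool) : boolSign (!b) = -boolSign b := by cases b <;> simp [boolSign]

/-- Pathwise form of Doob's `L²` maximal inequality for the signed partial sums taken in the order
of increasing `t`. -/
lemma exists_bound_signed_partial_sums {ι : Type*} [Fintype ι] [DecidableEq ι] (t w : ι → ℝ)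
    (s : Finset ι) :
    ∃ M : (ι → Bool) → ℝ, (∀ ε, 0 ≤ M ε) ∧
      (∀ ε a, ∑ i ∈ s with t i ≤ a, boolSign (ε i) * w i ≤ M ε) ∧
      (∀ i ∉ s, ∀ ε b, M (Function.update ε i b) = M ε) ∧
      ∑ ε : ι → Bool, (M ε ^ 2 / 2 - M ε * ∑ i ∈ s, boolSign (ε i) * w i
        + (∑ i ∈ s, boolSign (ε i) * w i) ^ 2) ≤ 2 ^ Fintype.card ι * ∑ i ∈ s, w i ^ 2 := by
  induction s using Finset.induction_on_max_value t with
  | empty => exact ⟨fun _ => 0, by simp⟩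
  | insert a s ha hmax ih =>
    obtain ⟨M, hM0, hMb, hMu, hMs⟩ := ih
    set S : (ι → Bool) → ℝ := fun ε => ∑ i ∈ s, boolSign (ε i) * w i with hS
    have hSu : ∀ i ∉ s, ∀ ε b, S (Function.update ε i b) = S ε := by
      intro i hi ε b
      refine Finset.sum_congr rfl fun j hj => ?_
      rw [Function.update_of_ne (ne_of_mem_of_not_mem hj hi)]
    simp only [Finset.sum_insert ha]
    refine ⟨fun ε => max (M ε) (boolSign (ε a) * w a + S ε),
      fun ε => le_max_of_le_left (hM0 ε), ?_, ?_, ?_⟩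
    · intro ε b
      by_cases hab : t a ≤ b
      · refine le_max_of_le_right (le_of_eq ?_)
        rw [Finset.filter_true_of_mem, Finset.sum_insert ha]
        intro i hi
        rcases Finset.mem_insert.1 hi with rfl | hi
        · exact hab
        · exact (hmax i hi).trans hab
      · rw [Finset.filter_insert, if_neg hab]
        exact le_max_of_le_left (hMb ε b)
    · intro i hi ε b
      rw [Finset.mem_insert, not_or] at hi
      simp only [hMu i hi.2, hSu i hi.2, Function.update_of_ne (Ne.symm hi.1)]
    · have hzero : ∑ ε : ι → Bool, boolSign (ε a) * (w a * (2 * S ε - M ε)) = 0 := by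
        refine Finset.sum_involution (fun ε _ => Function.update ε a (!ε a)) ?_ ?_ ?_ ?_
        · intro ε _
          simp only [hMu a ha, hSu a ha, Function.update_self, boolSign_not]
          ring
        · intro ε _ _ h
          have := congrFun h a
          simp at this
        · simp
        · simp
      calc _ ≤ ∑ ε : ι → Bool, ((M ε ^ 2 / 2 - M ε * S ε + S ε ^ 2) + w a ^ 2
            + boolSign (ε a) * (w a * (2 * S ε - M ε))) := by
            refine Finset.sum_le_sum fun ε _ => ?_
            have h1 := boolSign_sq (ε a)
            change max _ _ ^ 2 / 2 - max _ _ * (_ + S ε) + (_ + S ε) ^ 2 ≤ _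
            rcases le_total (M ε) (boolSign (ε a) * w a + S ε) with h | h
            · rw [max_eq_right h]
              nlinarith [sq_nonneg (boolSign (ε a) * w a + S ε - M ε)]
            · rw [max_eq_left h]
              nlinarith
        _ ≤ _ := by
            rw [Finset.sum_add_distrib, Finset.sum_add_distrib, hzero, Finset.sum_const,
              Finset.card_univ, Fintype.card_fun, Fintype.card_bool, nsmul_eq_mul]
            push_cast
            linarith

/-- Expected maximal signed sum over lower half-lines. -/
lemma exists_bound_signed_sum_le {n : ℕ} (hn : 0 < n) (t w : Fin n → ℝ) (hw : ∀ i, |w i| ≤ 1) :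
    ∃ M : (Fin n → Bool) → ℝ, (∀ ε, 0 ≤ M ε) ∧
      (∀ ε a, ∑ i with t i ≤ a, boolSign (ε i) * w i ≤ M ε) ∧
      ∑ ε, M ε ≤ 2 ^ n * (2 * √n) := by
  obtain ⟨M, h0, hb, -, hs⟩ := exists_bound_signed_partial_sums t w Finset.univ
  refine ⟨M, h0, hb, ?_⟩
  have hr : 0 < √(n:ℝ) := Real.sqrt_pos.2 (by exact_mod_cast hn)
  have hr2 : √(n:ℝ) ^ 2 = n := Real.sq_sqrt (by positivity)
  have hw2 : ∑ i, w i ^ 2 ≤ n := by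
    calc ∑ i, w i ^ 2 ≤ ∑ _i : Fin n, (1:ℝ) :=
          Finset.sum_le_sum fun i _ => (sq_le_one_iff_abs_le_one _).2 (hw i)
      _ = n := by simp
  have hq : ∑ ε, M ε ^ 2 / 4 ≤ 2 ^ n * (n:ℝ) := by
    calc ∑ ε, M ε ^ 2 / 4 ≤ _ := Finset.sum_le_sum fun ε _ => by
          nlinarith [sq_nonneg (M ε / 2 - ∑ i, boolSign (ε i) * w i)]
      _ ≤ _ := hs
      _ ≤ 2 ^ n * (n:ℝ) := by
          rw [Fintype.card_fin]
          gcongr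
  have hpt : ∀ ε, M ε * √n ≤ M ε ^ 2 / 4 + n := fun ε => by
    nlinarith [sq_nonneg (M ε / 2 - √n)]
  have hsum : (∑ ε, M ε) * √n ≤ 2 ^ n * (n:ℝ) + 2 ^ n * n := by
    rw [Finset.sum_mul]
    calc _ ≤ ∑ ε, (M ε ^ 2 / 4 + n) := Finset.sum_le_sum fun ε _ => hpt ε
      _ ≤ _ := by
        rw [Finset.sum_add_distrib, Finset.sum_const, Finset.card_univ, Fintype.card_fun,
          Fintype.card_bool, Fintype.card_fin, nsmul_eq_mul]
        push_cast
        linarith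
  refine le_of_mul_le_mul_right (hsum.trans (le_of_eq ?_)) hr
  linear_combination (-2 * 2 ^ n) * hr2

/-- Expected maximal absolute signed sum over half-open intervals. -/
lemma exists_bound_signed_sum_Ioc {n : ℕ} (hn : 0 < n) (t w : Fin n → ℝ) (hw : ∀ i, |w i| ≤ 1) :
    ∃ R : (Fin n → Bool) → ℝ,
      (∀ ε a b, |∑ i, boolSign (ε i) * (w i * (Ioc a b).indicator (1 : ℝ → ℝ) (t i))| ≤ R ε) ∧
      ∑ ε, R ε ≤ 2 ^ n * (4 * √n) := by
  obtain ⟨M, hM0, hMb, hMs⟩ := exists_bound_signed_sum_le hn t w hw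
  obtain ⟨N, hN0, hNb, hNs⟩ := exists_bound_signed_sum_le hn t (fun i => -w i) (by simpa using hw)
  refine ⟨fun ε => M ε + N ε, fun ε a b => ?_, ?_⟩
  · have hdec : ∑ i, boolSign (ε i) * (w i * (Ioc a b).indicator (1 : ℝ → ℝ) (t i))
        = ∑ i with t i ≤ b, boolSign (ε i) * w i
          - ∑ i with t i ≤ min a b, boolSign (ε i) * w i := by
      rw [Finset.sum_filter, Finset.sum_filter, ← Finset.sum_sub_distrib]
      refine Finset.sum_congr rfl fun i _ => ?_
      by_cases h1 : t i ≤ a <;> by_cases h2 : t i ≤ b <;>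
        simp [Set.indicator, h1, h2, not_lt.2, not_le.1]
    have hneg : ∀ c, -∑ i with t i ≤ c, boolSign (ε i) * w i ≤ N ε := fun c => by
      have := hNb ε c
      simpa using this
    rw [hdec, abs_le]
    constructor <;> linarith [hMb ε b, hMb ε (min a b), hneg b, hneg (min a b)]
  · rw [Finset.sum_add_distrib]
    linarith

open ProbabilityTheory in
/-- McDiarmid's bounded differences inequality, as a sub-Gaussian moment generating function. -/
theorem hasSubgaussianMGF_of_bounded_differences {Z : Type*} [MeasurableSpace Z]
    (P : Measure Z) [IsProbabilityMeasure P] (c : NNReal) (n : ℕ) (F : (Fin n → Z) → ℝ)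
    (hF : Measurable F) (B : ℝ) (hB : ∀ z, |F z| ≤ B)
    (hdiff : ∀ z i x, |F (Function.update z i x) - F z| ≤ c) :
    HasSubgaussianMGF (fun z => F z - ∫ z, F z ∂Measure.pi fun _ => P) (n * (c / 2) ^ 2)
      (Measure.pi fun _ => P) := by
  have hintexp : ∀ {Ω : Type _} [MeasurableSpace Ω] (μ : Measure Ω) [IsProbabilityMeasure μ]
      (G : Ω → ℝ) (_ : Measurable G) (_ : ∀ z, |G z| ≤ B) (s e : ℝ),
      Integrable (fun z => Real.exp (s * (G z - e))) μ := by
    intro Ω _ μ _ G hG hGB s e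
    refine integrable_exp_mul_of_mem_Icc (a := -B - e) (b := B - e)
      (hG.sub_const e).aemeasurable (Filter.Eventually.of_forall fun z => ?_)
    have := abs_le.1 (hGB z)
    exact ⟨by linarith [this.1], by linarith [this.2]⟩
  refine ⟨fun s => hintexp _ F hF hB s _, fun s => ?_⟩
  obtain ⟨z₀⟩ : Nonempty Z := P.nonempty_of_neZero
  induction n with
  | zero =>
    have hconst : ∀ z, F z = F (fun _ => z₀) := fun z => congrArg F (Subsingleton.elim _ _)
    simp [mgf, hconst]
  | succ n ih =>
    set μ : Measure (Fin n → Z) := Measure.pi fun _ => P with hμ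
    have hsymm : ∀ (x : Z) (w : Fin n → Z),
        (MeasurableEquiv.piFinSuccAbove (fun _ : Fin (n + 1) => Z) 0).symm (x, w)
          = (Fin.cons x w : Fin (n + 1) → Z) := fun x w => by
      simp [MeasurableEquiv.piFinSuccAbove, Fin.consEquiv]
    have hcons : Measurable fun p : Z × (Fin n → Z) => (Fin.cons p.1 p.2 : Fin (n + 1) → Z) := by
      simp only [← hsymm]
      exact (MeasurableEquiv.piFinSuccAbove (fun _ : Fin (n + 1) => Z) 0).symm.measurable
    have hint : ∀ G : (Fin (n + 1) → Z) → ℝ, ∫ z, G z ∂(Measure.pi fun _ => P)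
        = ∫ p : Z × (Fin n → Z), G (Fin.cons p.1 p.2) ∂(P.prod μ) := fun G => by
      simp only [← hsymm]
      exact ((measurePreserving_piFinSuccAbove (fun _ : Fin (n + 1) => P) 0).symm.integral_comp' G).symm
    have hK : Measurable fun p : Z × (Fin n → Z) => F (Fin.cons p.1 p.2) := hF.comp hcons
    have hKint : Integrable (fun p : Z × (Fin n → Z) => F (Fin.cons p.1 p.2)) (P.prod μ) :=
      Integrable.of_bound hK.aestronglyMeasurable B (Filter.Eventually.of_forall fun p => hB _)
    set G : Z → ℝ := fun x => ∫ w, F (Fin.cons x w) ∂μ with hGdef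
    have hG : Measurable G := hK.stronglyMeasurable.integral_prod_right.measurable
    have hGint : ∀ x, Integrable (fun w => F (Fin.cons x w)) μ := fun x =>
      Integrable.of_bound (hK.comp measurable_prodMk_left).aestronglyMeasurable B
        (Filter.Eventually.of_forall fun p => hB _)
    have hGB : ∀ x, |G x| ≤ B := fun x => by
      have := norm_integral_le_of_norm_le_const (μ := μ)
        (f := fun w => F (Fin.cons x w)) (C := B)
        (Filter.Eventually.of_forall fun w => hB (Fin.cons x w))
      simpa using this
    have hGosc : ∀ x x', G x ≤ G x' + c := fun x x' => by
      have h1 : G x ≤ ∫ w, (F (Fin.cons x' w) + c) ∂μ := by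
        refine integral_mono (hGint x) ((hGint x').add (integrable_const _)) fun w => ?_
        have := hdiff (Fin.cons x' w) 0 x
        rw [Fin.update_cons_zero] at this
        linarith [(abs_le.1 this).2]
      rw [integral_add (hGint x') (integrable_const _)] at h1
      simpa using h1
    have hGbdd : BddBelow (range G) := ⟨-B, by rintro _ ⟨x, rfl⟩; exact (abs_le.1 (hGB x)).1⟩
    have : Nonempty Z := ⟨z₀⟩
    have hHoeff := (hasSubgaussianMGF_of_mem_Icc (μ := P) (X := G) (a := ⨅ x, G x)
      (b := (⨅ x, G x) + c) hG.aemeasurable (Filter.Eventually.of_forall fun x =>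
        ⟨ciInf_le hGbdd x, by
          rw [← sub_le_iff_le_add]
          exact le_ciInf fun x' => by linarith [hGosc x x']⟩)).mgf_le s
    have hmean : ∫ z, F z ∂(Measure.pi fun _ => P) = ∫ x, G x ∂P := by
      rw [hint, integral_prod _ hKint]
    have hinner : ∀ x, ∫ w, Real.exp (s * (F (Fin.cons x w) - G x)) ∂μ
        ≤ Real.exp (n * (c / 2) ^ 2 * s ^ 2 / 2) := fun x => by
      have := ih (fun w => F (Fin.cons x w)) (hK.comp measurable_prodMk_left)
        (fun w => hB _) (fun w i y => by
          rw [Fin.cons_update]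
          exact hdiff _ _ _)
      simpa [mgf] using this
    have hfub : mgf (fun z => F z - ∫ z, F z ∂Measure.pi fun _ => P) (Measure.pi fun _ => P) s
        = ∫ x, Real.exp (s * (G x - ∫ x, G x ∂P)) *
            ∫ w, Real.exp (s * (F (Fin.cons x w) - G x)) ∂μ ∂P := by
      rw [mgf, hint, hmean, integral_prod _ (hintexp _ _ hK (fun p => hB _) s _)]
      refine integral_congr_ae (Filter.Eventually.of_forall fun x => ?_)
      dsimp only
      rw [← integral_const_mul]
      refine integral_congr_ae (Filter.Eventually.of_forall fun w => ?_)
      dsimp only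
      rw [← Real.exp_add]
      congr 1
      ring
    rw [hfub]
    calc _ ≤ ∫ x, Real.exp (s * (G x - ∫ x, G x ∂P)) *
            Real.exp (n * (c / 2) ^ 2 * s ^ 2 / 2) ∂P := by
          refine integral_mono_of_nonneg (Filter.Eventually.of_forall fun x =>
            mul_nonneg (Real.exp_pos _).le (integral_nonneg fun w => (Real.exp_pos _).le))
            ((hintexp P G hG hGB s _).mul_const _) (Filter.Eventually.of_forall fun x => ?_)
          exact mul_le_mul_of_nonneg_left (hinner x) (Real.exp_pos _).le
      _ ≤ Real.exp ((c / 2) ^ 2 * s ^ 2 / 2) * Real.exp (n * (c / 2) ^ 2 * s ^ 2 / 2) := by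
          rw [integral_mul_const]
          refine mul_le_mul_of_nonneg_right ?_ (Real.exp_pos _).le
          simpa [mgf] using hHoeff
      _ = _ := by
          rw [← Real.exp_add]
          congr 1
          push_cast
          ring

/-- The uniform deviation `sup_j |(1/n) ∑ g_j(z_i) - E g_j|` of a sample over a function class. -/
noncomputable def uniformDeviation {Z J : Type*} [MeasurableSpace Z] (P : Measure Z)
    (g : J → Z → ℝ) {n : ℕ} (z : Fin n → Z) : ℝ :=
  ⨆ j, |(n:ℝ)⁻¹ * ∑ i, g j (z i) - ∫ x, g j x ∂P|

lemma abs_empirical_mean_le {Z J : Type*} (g : J → Z → ℝ) {n : ℕ} (hg1 : ∀ j x, |g j x| ≤ 1) (j : J) (z : Fin n → Z) :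
    |(n:ℝ)⁻¹ * ∑ i, g j (z i)| ≤ 1 := by
  rw [abs_mul, abs_of_nonneg (by positivity), inv_mul_eq_div]
  refine div_le_one_of_le₀ ((Finset.abs_sum_le_sum_abs _ _).trans ?_) (by positivity)
  calc _ ≤ ∑ _i : Fin n, (1:ℝ) := Finset.sum_le_sum fun i _ => hg1 j _
    _ = n := by simp

section UniformDeviation

variable {Z J : Type*} [MeasurableSpace Z] (P : Measure Z) (g : J → Z → ℝ) {n : ℕ}

lemma measurable_uniformDeviation [Countable J] (hg : ∀ j, Measurable (g j)) :
    Measurable fun z : Fin n → Z => uniformDeviation P g z := by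
  unfold uniformDeviation
  refine Measurable.iSup fun j => ?_
  refine Measurable.abs (Measurable.sub_const (Measurable.const_mul ?_ _) _)
  exact Finset.measurable_sum _ fun i _ => (hg j).comp (measurable_pi_apply i)

variable [IsProbabilityMeasure P]

lemma abs_deviation_le_two (hg1 : ∀ j x, |g j x| ≤ 1) (j : J) (z : Fin n → Z) :
    |(n:ℝ)⁻¹ * ∑ i, g j (z i) - ∫ x, g j x ∂P| ≤ 2 := by
  have h1 := abs_empirical_mean_le g hg1 j z
  have h2 : |∫ x, g j x ∂P| ≤ 1 := by
    simpa using norm_integral_le_of_norm_le_const (μ := P) (f := g j) (C := 1)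
      (Filter.Eventually.of_forall fun x => hg1 j x)
  exact (abs_sub _ _).trans (by linarith)

lemma bddAbove_deviation (hg1 : ∀ j x, |g j x| ≤ 1) (z : Fin n → Z) :
    BddAbove (range fun j => |(n:ℝ)⁻¹ * ∑ i, g j (z i) - ∫ x, g j x ∂P|) :=
  ⟨2, by rintro _ ⟨j, rfl⟩; exact abs_deviation_le_two P g hg1 j z⟩

lemma deviation_le_uniformDeviation (hg1 : ∀ j x, |g j x| ≤ 1) (z : Fin n → Z) (j : J) :
    |(n:ℝ)⁻¹ * ∑ i, g j (z i) - ∫ x, g j x ∂P| ≤ uniformDeviation P g z :=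
  le_ciSup (bddAbove_deviation P g hg1 z) j

lemma abs_uniformDeviation_le [Nonempty J] (hg1 : ∀ j x, |g j x| ≤ 1) (z : Fin n → Z) :
    |uniformDeviation P g z| ≤ 2 := by
  rw [uniformDeviation, abs_of_nonneg (Real.iSup_nonneg fun j => abs_nonneg _)]
  exact ciSup_le fun j => abs_deviation_le_two P g hg1 j z

lemma uniformDeviation_update_le [Nonempty J] (hg1 : ∀ j x, |g j x| ≤ 1) (z : Fin n → Z)
    (i : Fin n) (x : Z) :
    uniformDeviation P g (Function.update z i x) ≤ uniformDeviation P g z + 2 / n := by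
  refine ciSup_le fun j => ?_
  have h0 := deviation_le_uniformDeviation P g hg1 z j
  have h1 : ∑ k, g j (Function.update z i x k) = ∑ k, g j (z k) + (g j x - g j (z i)) := by
    rw [← sub_eq_iff_eq_add', ← Finset.sum_sub_distrib, Finset.sum_eq_single i]
    · simp
    · intro k _ hk
      simp [Function.update_of_ne hk]
    · simp
  have h2 : |(n:ℝ)⁻¹ * (g j x - g j (z i))| ≤ 2 / n := by
    rw [abs_mul, abs_of_nonneg (by positivity), inv_mul_eq_div]
    gcongr
    exact (abs_sub _ _).trans (by linarith [hg1 j x, hg1 j (z i)])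
  rw [h1, mul_add, add_sub_right_comm]
  exact (abs_add_le _ _).trans (by linarith)

lemma abs_uniformDeviation_update_sub_le [Nonempty J] (hg1 : ∀ j x, |g j x| ≤ 1) (z : Fin n → Z)
    (i : Fin n) (x : Z) :
    |uniformDeviation P g (Function.update z i x) - uniformDeviation P g z| ≤ 2 / n := by
  rw [abs_le]
  have h1 := uniformDeviation_update_le P g hg1 z i x
  have h2 := uniformDeviation_update_le P g hg1 (Function.update z i x) i (z i)
  rw [Function.update_idem, Function.update_eq_self] at h2
  constructor <;> linarith

/-- Exchanging the coordinates of two independent samples at the indices where `ε` is `false`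
preserves their joint law. -/
lemma measurePreserving_coordinate_swap (ε : Fin n → Bool) :
    MeasurePreserving
      (fun p : (Fin n → Z) × (Fin n → Z) =>
        ((fun i => if ε i then p.1 i else p.2 i, fun i => if ε i then p.2 i else p.1 i) :
          (Fin n → Z) × (Fin n → Z)))
      ((Measure.pi fun _ => P).prod (Measure.pi fun _ => P))
      ((Measure.pi fun _ => P).prod (Measure.pi fun _ => P)) := by
  have he := measurePreserving_arrowProdEquivProdArrow Z Z (Fin n) (fun _ => P) (fun _ => P)
  have hs : ∀ i, MeasurePreserving (if ε i then id else Prod.swap) (P.prod P) (P.prod P) := by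
    intro i
    cases ε i
    · exact Measure.measurePreserving_swap
    · exact MeasurePreserving.id _
  convert he.comp ((measurePreserving_pi _ _ hs).comp he.symm) using 1
  funext p
  ext i <;> cases h : ε i <;>
    simp [MeasurableEquiv.arrowProdEquivProdArrow, Equiv.arrowProdEquivProdArrow, h]

/-- Symmetrization: a bound on the conditional Rademacher averages of a function class bounds its
expected uniform deviation. -/
theorem integral_uniformDeviation_le [Countable J] [Nonempty J] (hn : 0 < n)
    (hg : ∀ j, Measurable (g j)) (hg1 : ∀ j x, |g j x| ≤ 1) (C : ℝ)
    (hC : ∀ z z' : Fin n → Z, ∃ R : (Fin n → Bool) → ℝ,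
      (∀ ε j, |∑ i, boolSign (ε i) * (g j (z i) - g j (z' i))| ≤ R ε) ∧
        ∑ ε, R ε ≤ 2 ^ n * C) :
    ∫ z : Fin n → Z, uniformDeviation P g z ∂(Measure.pi fun _ => P) ≤ C / n := by
  set μ : Measure (Fin n → Z) := Measure.pi fun _ => P with hμ
  have hnR : (0:ℝ) < n := by exact_mod_cast hn
  set W : (Fin n → Z) × (Fin n → Z) → ℝ := fun p => ⨆ j, |∑ i, (g j (p.1 i) - g j (p.2 i))|
    with hW
  have hWj : ∀ (p : (Fin n → Z) × (Fin n → Z)) j, |∑ i, (g j (p.1 i) - g j (p.2 i))| ≤ 2 * n := fun p j => by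
    refine (Finset.abs_sum_le_sum_abs _ _).trans ?_
    calc _ ≤ ∑ _i : Fin n, (2:ℝ) := Finset.sum_le_sum fun i _ =>
          (abs_sub _ _).trans (by linarith [hg1 j (p.1 i), hg1 j (p.2 i)])
      _ = 2 * n := by simp [mul_comm]
  have hWbdd : ∀ p : (Fin n → Z) × (Fin n → Z),
      BddAbove (range fun j => |∑ i, (g j (p.1 i) - g j (p.2 i))|) := fun p =>
    ⟨2 * n, by rintro _ ⟨j, rfl⟩; exact hWj p j⟩
  have hWm : Measurable W := Measurable.iSup fun j => Measurable.abs <|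
    Finset.measurable_sum _ fun i _ =>
      ((hg j).comp ((measurable_pi_apply i).comp measurable_fst)).sub
        ((hg j).comp ((measurable_pi_apply i).comp measurable_snd))
  have hWB : ∀ p, ‖W p‖ ≤ 2 * n := fun p => by
    rw [Real.norm_eq_abs, abs_of_nonneg (Real.iSup_nonneg fun j => abs_nonneg _)]
    exact ciSup_le fun j => hWj p j
  have hWint : Integrable W (μ.prod μ) :=
    Integrable.of_bound hWm.aestronglyMeasurable _ (Filter.Eventually.of_forall hWB)
  have hWint2 : ∀ z, Integrable (fun z' => W (z, z')) μ := fun z =>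
    Integrable.of_bound (hWm.comp measurable_prodMk_left).aestronglyMeasurable _
      (Filter.Eventually.of_forall fun z' => hWB (z, z'))
  have hgint : ∀ j, Integrable (g j) P := fun j =>
    Integrable.of_bound (hg j).aestronglyMeasurable 1 (Filter.Eventually.of_forall (hg1 j))
  have heval : ∀ i : Fin n, MeasurePreserving (Function.eval i) μ P :=
    measurePreserving_eval (fun _ => P)
  have hgi : ∀ j i, Integrable (fun z : Fin n → Z => g j (z i)) μ := fun j i =>
    (heval i).integrable_comp_of_integrable (hgint j)
  have hgmean : ∀ j i, ∫ z : Fin n → Z, g j (z i) ∂μ = ∫ x, g j x ∂P := fun j i => by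
    rw [← (heval i).map_eq, integral_map (heval i).aemeasurable (hg j).aestronglyMeasurable]
  have hghost : ∀ z : Fin n → Z, uniformDeviation P g z ≤ (n:ℝ)⁻¹ * ∫ z', W (z, z') ∂μ := by
    intro z
    refine ciSup_le fun j => ?_
    have h1 : (n:ℝ)⁻¹ * ∑ i, g j (z i) - ∫ x, g j x ∂P
        = (n:ℝ)⁻¹ * ∫ z' : Fin n → Z, ∑ i, (g j (z i) - g j (z' i)) ∂μ := by
      rw [integral_finsetSum (f := fun i (z' : Fin n → Z) => g j (z i) - g j (z' i)) _
        fun i _ => (integrable_const _).sub (hgi j i)]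
      simp_rw [integral_sub (integrable_const _) (hgi j _), hgmean]
      simp only [Finset.sum_sub_distrib, integral_const, probReal_univ, one_smul, Finset.sum_const,
        Finset.card_univ, Fintype.card_fin, nsmul_eq_mul]
      field_simp
    rw [h1, abs_mul, abs_of_nonneg (by positivity : (0:ℝ) ≤ (n:ℝ)⁻¹)]
    refine mul_le_mul_of_nonneg_left ?_ (by positivity)
    refine (abs_integral_le_integral_abs).trans ?_
    refine integral_mono_of_nonneg (Filter.Eventually.of_forall fun _ => abs_nonneg _) (hWint2 z)
      (Filter.Eventually.of_forall fun z' => ?_)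
    exact le_ciSup (hWbdd (z, z')) j
  have hswap : ∀ ε : Fin n → Bool, ∀ p : (Fin n → Z) × (Fin n → Z),
      W (fun i => if ε i then p.1 i else p.2 i, fun i => if ε i then p.2 i else p.1 i)
        = ⨆ j, |∑ i, boolSign (ε i) * (g j (p.1 i) - g j (p.2 i))| := by
    intro ε p
    simp only [hW]
    refine iSup_congr fun j => congrArg abs (Finset.sum_congr rfl fun i _ => ?_)
    cases ε i <;> simp [boolSign]
  have hWC : 2 ^ n * ∫ p, W p ∂(μ.prod μ) ≤ 2 ^ n * C := by
    have hmp := measurePreserving_coordinate_swap (n := n) P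
    have h1 : ∀ ε : Fin n → Bool, ∫ p, W p ∂(μ.prod μ) = ∫ p : (Fin n → Z) × (Fin n → Z),
        ⨆ j, |∑ i, boolSign (ε i) * (g j (p.1 i) - g j (p.2 i))| ∂(μ.prod μ) := by
      intro ε
      conv_lhs => rw [← (hmp ε).map_eq,
        integral_map (hmp ε).aemeasurable hWm.aestronglyMeasurable]
      simp only [hswap]
      rfl
    have h2 : ∀ ε : Fin n → Bool, Integrable (fun p : (Fin n → Z) × (Fin n → Z) =>
        ⨆ j, |∑ i, boolSign (ε i) * (g j (p.1 i) - g j (p.2 i))|) (μ.prod μ) := by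
      intro ε
      simp only [← hswap]
      exact (hmp ε).integrable_comp_of_integrable hWint
    calc 2 ^ n * ∫ p, W p ∂(μ.prod μ) = ∑ _ε : Fin n → Bool, ∫ p, W p ∂(μ.prod μ) := by simp
      _ = ∫ p : (Fin n → Z) × (Fin n → Z),
          ∑ ε : Fin n → Bool, ⨆ j, |∑ i, boolSign (ε i) * (g j (p.1 i) - g j (p.2 i))|
            ∂(μ.prod μ) := by
          rw [integral_finsetSum _ fun ε _ => h2 ε]
          exact Finset.sum_congr rfl fun ε _ => h1 ε
      _ ≤ ∫ _p : (Fin n → Z) × (Fin n → Z), 2 ^ n * C ∂(μ.prod μ) := by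
          refine integral_mono (integrable_finsetSum _ fun ε _ => h2 ε) (integrable_const _)
            fun p => ?_
          obtain ⟨R, hR, hRs⟩ := hC p.1 p.2
          exact (Finset.sum_le_sum fun ε _ => ciSup_le fun j => hR ε j).trans hRs
      _ = 2 ^ n * C := by simp
  have hWC' : ∫ p, W p ∂(μ.prod μ) ≤ C := le_of_mul_le_mul_left hWC (by positivity)
  calc _ ≤ ∫ z, (n:ℝ)⁻¹ * ∫ z', W (z, z') ∂μ ∂μ :=
        integral_mono_of_nonneg
          (Filter.Eventually.of_forall fun z => Real.iSup_nonneg fun j => abs_nonneg _)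
          (hWint.integral_prod_left.const_mul _) (Filter.Eventually.of_forall hghost)
    _ = (n:ℝ)⁻¹ * ∫ p, W p ∂(μ.prod μ) := by rw [integral_const_mul, integral_prod _ hWint]
    _ ≤ C / n := by
        rw [div_eq_inv_mul]
        exact mul_le_mul_of_nonneg_left hWC' (by positivity)

/-- High-probability bound on the uniform deviation around its mean. -/
theorem measureReal_uniformDeviation_ge_le [Countable J] [Nonempty J] (hn : 0 < n)
    (hg : ∀ j, Measurable (g j)) (hg1 : ∀ j x, |g j x| ≤ 1) {t : ℝ} (ht : 0 ≤ t) :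
    (Measure.pi fun _ : Fin n => P).real {z | t ≤ uniformDeviation P g z
      - ∫ z : Fin n → Z, uniformDeviation P g z ∂(Measure.pi fun _ => P)}
      ≤ Real.exp (-n * t ^ 2 / 2) := by
  have hnR : (0:ℝ) < n := by exact_mod_cast hn
  have h := (hasSubgaussianMGF_of_bounded_differences P (2 / n) n
    (fun z => uniformDeviation P g z) (measurable_uniformDeviation P g hg) 2
    (abs_uniformDeviation_le P g hg1) (fun z i x => by
      simpa using abs_uniformDeviation_update_sub_le P g hg1 z i x)).measure_ge_le ht
  refine h.trans (le_of_eq ?_)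
  congr 1
  push_cast
  field_simp

end UniformDeviation

/-- Lower sets of reals are pointwise limits of closed rational half-lines. -/
lemma IsLowerSet.exists_seq_rat {L : Set ℝ} (hL : IsLowerSet L) :
    ∃ q : ℕ → ℚ, ∀ x : ℝ, ∀ᶠ k in Filter.atTop, (x ≤ q k ↔ x ∈ L) := by
  rcases L.eq_empty_or_nonempty with rfl | hne
  · refine ⟨fun k => -k, fun x => ?_⟩
    filter_upwards [(tendsto_natCast_atTop_atTop (R := ℝ)).eventually_gt_atTop (-x)] with k hk
    simp only [mem_empty_iff_false, iff_false, not_le]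
    push_cast
    linarith
  by_cases hb : BddAbove L
  · by_cases hc : sSup L ∈ L
    · obtain ⟨u, -, hu, hlim⟩ := Real.exists_seq_rat_strictAnti_tendsto (sSup L)
      refine ⟨u, fun x => ?_⟩
      by_cases hx : x ∈ L
      · exact Filter.Eventually.of_forall fun k =>
          ⟨fun _ => hx, fun _ => (le_csSup hb hx).trans (hu k).le⟩
      · have hlt : sSup L < x := not_le.1 fun h => hx (hL h hc)
        filter_upwards [hlim.eventually (gt_mem_nhds hlt)] with k hk
        simp [hx, hk]
    · obtain ⟨u, -, hu, hlim⟩ := Real.exists_seq_rat_strictMono_tendsto (sSup L)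
      refine ⟨u, fun x => ?_⟩
      by_cases hx : x ∈ L
      · have hlt : x < sSup L := lt_of_le_of_ne (le_csSup hb hx) fun h => hc (h ▸ hx)
        filter_upwards [hlim.eventually (lt_mem_nhds hlt)] with k hk
        simp only [hx, iff_true]
        exact hk.le
      · refine Filter.Eventually.of_forall fun k => ⟨fun h => ?_, fun h => absurd h hx⟩
        obtain ⟨y, hy, hlt⟩ := exists_lt_of_lt_csSup hne (h.trans_lt (hu k))
        exact hL hlt.le hy
  · refine ⟨fun k => k, fun x => ?_⟩
    obtain ⟨y, hy, hxy⟩ := not_bddAbove_iff.1 hb x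
    filter_upwards [(tendsto_natCast_atTop_atTop (R := ℝ)).eventually_ge_atTop x] with k hk
    simpa [hL hxy.le hy] using hk

/-- Indicators of real intervals are pointwise limits of indicators of half-open rational
intervals. -/
lemma Set.OrdConnected.exists_seq_rat_tendsto_indicator {A : Set ℝ} (hA : A.OrdConnected) :
    ∃ q : ℕ → ℚ × ℚ, ∀ x : ℝ, Filter.Tendsto
      (fun k => (Ioc ((q k).1 : ℝ) (q k).2).indicator (1 : ℝ → ℝ) x) Filter.atTop
      (nhds (A.indicator (1 : ℝ → ℝ) x)) := by
  obtain ⟨a, ha⟩ := IsLowerSet.exists_seq_rat (L := {x | ∀ y ∈ A, x < y})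
    fun x y hyx hx z hz => hyx.trans_lt (hx z hz)
  obtain ⟨b, hb⟩ := IsLowerSet.exists_seq_rat (L := {x | ∃ y ∈ A, x ≤ y})
    fun x y hyx ⟨z, hz, hxz⟩ => ⟨z, hz, hyx.trans hxz⟩
  refine ⟨fun k => (a k, b k), fun x => ?_⟩
  have hmem : x ∈ A ↔ (∃ y ∈ A, x ≤ y) ∧ ¬∀ y ∈ A, x < y := by
    constructor
    · exact fun hx => ⟨⟨x, hx, le_rfl⟩, fun h => lt_irrefl _ (h x hx)⟩
    · rintro ⟨⟨y, hy, hxy⟩, h⟩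
      push Not at h
      obtain ⟨z, hz, hzx⟩ := h
      exact hA.out hz hy ⟨hzx, hxy⟩
  refine tendsto_const_nhds.congr' ?_
  filter_upwards [ha x, hb x] with k hak hbk
  have : x ∈ Ioc (a k : ℝ) (b k) ↔ x ∈ A := by
    rw [mem_Ioc, hmem, hbk, ← not_le, hak, and_comm]
  by_cases hx : x ∈ A <;> simp only [Set.indicator, this, hx]

/-- Truncation of a real to `[0,1]`. -/
def clampUnit (y : ℝ) : ℝ := max 0 (min y 1)

lemma clampUnit_mem (y : ℝ) : clampUnit y ∈ Icc (0:ℝ) 1 :=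
  ⟨le_max_left _ _, max_le zero_le_one (min_le_right _ _)⟩

lemma clampUnit_of_mem {y : ℝ} (hy : y ∈ Icc (0:ℝ) 1) : clampUnit y = y := by
  rw [clampUnit, min_eq_left hy.2, max_eq_right hy.1]

lemma measurable_clampUnit : Measurable clampUnit := by
  unfold clampUnit
  fun_prop

/-- The residual-type function `Y 1{f(X) ∈ A} - 1{f(X) ∈ B}` with `Y` truncated to `[0,1]`. -/
noncomputable def setResidual {𝒳 : Type*} (f : 𝒳 → ℝ) (A B : Set ℝ) (p : 𝒳 × ℝ) : ℝ :=
  clampUnit p.2 * A.indicator (1 : ℝ → ℝ) (f p.1) - B.indicator (1 : ℝ → ℝ) (f p.1)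

/-- The residual functions of pairs of half-open rational intervals. -/
noncomputable def ratResidual {𝒳 : Type*} (f : 𝒳 → ℝ) (q : (ℚ × ℚ) × (ℚ × ℚ)) : 𝒳 × ℝ → ℝ :=
  setResidual f (Ioc q.1.1 q.1.2) (Ioc q.2.1 q.2.2)

lemma indicator_one_mem_Icc (A : Set ℝ) (x : ℝ) : A.indicator (1 : ℝ → ℝ) x ∈ Icc (0:ℝ) 1 := by
  by_cases hx : x ∈ A <;> simp [hx]

lemma abs_setResidual_le {𝒳 : Type*} (f : 𝒳 → ℝ) (A B : Set ℝ) (p : 𝒳 × ℝ) :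
    |setResidual f A B p| ≤ 1 := by
  have h1 := clampUnit_mem p.2
  have h2 := indicator_one_mem_Icc A (f p.1)
  have h3 := indicator_one_mem_Icc B (f p.1)
  have h4 := mul_le_one₀ h1.2 h2.1 h2.2
  have h5 := mul_nonneg h1.1 h2.1
  rw [setResidual, abs_le]
  constructor <;> linarith [h3.1, h3.2]

/-- Rademacher averages of the rational interval residuals. -/
lemma exists_bound_signed_ratResidual {𝒳 : Type*} (f : 𝒳 → ℝ) {n : ℕ} (hn : 0 < n) (z z' : Fin n → 𝒳 × ℝ) :
    ∃ R : (Fin n → Bool) → ℝ,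
      (∀ ε q, |∑ i, boolSign (ε i) * (ratResidual f q (z i) - ratResidual f q (z' i))| ≤ R ε) ∧
        ∑ ε, R ε ≤ 2 ^ n * (16 * √n) := by
  have hc : ∀ y, |clampUnit y| ≤ 1 := fun y => by
    rw [abs_of_nonneg (clampUnit_mem y).1]
    exact (clampUnit_mem y).2
  obtain ⟨R₁, h₁, s₁⟩ := exists_bound_signed_sum_Ioc hn (fun i => f (z i).1)
    (fun i => clampUnit (z i).2) fun i => hc _
  obtain ⟨R₂, h₂, s₂⟩ := exists_bound_signed_sum_Ioc hn (fun i => f (z i).1) (fun _ => 1) (by simp)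
  obtain ⟨R₃, h₃, s₃⟩ := exists_bound_signed_sum_Ioc hn (fun i => f (z' i).1)
    (fun i => clampUnit (z' i).2) fun i => hc _
  obtain ⟨R₄, h₄, s₄⟩ := exists_bound_signed_sum_Ioc hn (fun i => f (z' i).1) (fun _ => 1) (by simp)
  refine ⟨fun ε => R₁ ε + R₂ ε + R₃ ε + R₄ ε, fun ε q => ?_, ?_⟩
  · have e₁ := abs_le.1 (h₁ ε q.1.1 q.1.2)
    have e₂ := abs_le.1 (h₂ ε q.2.1 q.2.2)
    have e₃ := abs_le.1 (h₃ ε q.1.1 q.1.2)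
    have e₄ := abs_le.1 (h₄ ε q.2.1 q.2.2)
    simp only [ratResidual, setResidual, mul_sub, Finset.sum_sub_distrib]
    simp only [one_mul] at e₂ e₄
    rw [abs_le]
    constructor <;> linarith [e₁.1, e₁.2, e₂.1, e₂.2, e₃.1, e₃.2, e₄.1, e₄.2]
  · simp only [Finset.sum_add_distrib]
    linarith

section Residual

variable {𝒳 : Type*} [MeasurableSpace 𝒳] {f : 𝒳 → ℝ}

lemma measurable_setResidual (hf : Measurable f) {A B : Set ℝ} (hA : MeasurableSet A)
    (hB : MeasurableSet B) : Measurable (setResidual f A B) := by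
  refine ((measurable_clampUnit.comp measurable_snd).mul ?_).sub ?_
  · exact (measurable_one.indicator hA).comp (hf.comp measurable_fst)
  · exact (measurable_one.indicator hB).comp (hf.comp measurable_fst)

/-- A uniform bound on sample deviations passes to bounded pointwise limits. -/
lemma abs_deviation_le_of_tendsto {Z : Type*} [MeasurableSpace Z] (P : Measure Z)
    [IsProbabilityMeasure P] {n : ℕ} (z : Fin n → Z) {φ : ℕ → Z → ℝ} {ψ : Z → ℝ}
    (hφ : ∀ k, Measurable (φ k)) (hφ1 : ∀ k x, |φ k x| ≤ 1)
    (hlim : ∀ x, Filter.Tendsto (fun k => φ k x) Filter.atTop (nhds (ψ x))) {u : ℝ}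
    (hu : ∀ᶠ k in Filter.atTop, |(n:ℝ)⁻¹ * ∑ i, φ k (z i) - ∫ x, φ k x ∂P| ≤ u) :
    |(n:ℝ)⁻¹ * ∑ i, ψ (z i) - ∫ x, ψ x ∂P| ≤ u := by
  have hint : Filter.Tendsto (fun k => ∫ x, φ k x ∂P) Filter.atTop (nhds (∫ x, ψ x ∂P)) :=
    tendsto_integral_of_dominated_convergence (fun _ => 1)
      (fun k => (hφ k).aestronglyMeasurable) (integrable_const _)
      (fun k => Filter.Eventually.of_forall (hφ1 k)) (Filter.Eventually.of_forall hlim)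
  exact le_of_tendsto (((tendsto_finsetSum _ fun i _ => hlim (z i)).const_mul _).sub hint).abs hu

variable (P : Measure (𝒳 × ℝ)) [IsProbabilityMeasure P] {n : ℕ} (d : Fin n → 𝒳 × ℝ)

lemma abs_deviation_setResidual_le (hf : Measurable f) {A B : Set ℝ} (hA : A.OrdConnected)
    (hB : B.OrdConnected) :
    |(n:ℝ)⁻¹ * ∑ i, setResidual f A B (d i) - ∫ p, setResidual f A B p ∂P|
      ≤ uniformDeviation P (ratResidual f) d := by
  obtain ⟨a, ha⟩ := hA.exists_seq_rat_tendsto_indicator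
  obtain ⟨b, hb⟩ := hB.exists_seq_rat_tendsto_indicator
  refine abs_deviation_le_of_tendsto P d (φ := fun k => ratResidual f (a k, b k))
    (fun k => measurable_setResidual hf measurableSet_Ioc measurableSet_Ioc)
    (fun k => abs_setResidual_le f _ _) (fun p => ((ha _).const_mul _).sub (hb _))
    (Filter.Eventually.of_forall fun k => deviation_le_uniformDeviation P (ratResidual f)
      (fun _ => abs_setResidual_le f _ _) d (a k, b k))

lemma sum_indicator_threshold_eq_floor {h : ℝ} (h0 : 0 ≤ h) (h1 : h ≤ 1) {m : ℕ} (hm : 0 < m) :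
    ∑ k ∈ Finset.range m, (if ((k:ℝ) + 1) / m ≤ h then (1:ℝ) else 0) = ⌊h * m⌋₊ := by
  have hmR : (0:ℝ) < m := by exact_mod_cast hm
  rw [Finset.sum_boole]
  congr 1
  have hle : ⌊h * m⌋₊ ≤ m := Nat.floor_le_of_le (by nlinarith)
  have : Finset.filter (fun k : ℕ => ((k:ℝ) + 1) / m ≤ h) (Finset.range m)
      = Finset.range ⌊h * m⌋₊ := by
    ext k
    have hk : ((k:ℝ) + 1) / m ≤ h ↔ k < ⌊h * m⌋₊ := by
      rw [div_le_iff₀ hmR, ← Nat.succ_le_iff, Nat.le_floor_iff (by positivity)]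
      push_cast
      rfl
    rw [Finset.mem_filter, Finset.mem_range, Finset.mem_range, hk]
    omega
  rw [this, Finset.card_range]

/-- Sample deviations of the residuals of monotone fits, restricted to intervals, are controlled by
the class of rational interval residuals. -/
lemma abs_deviation_monotone_residual_le (hf : Measurable f) {H : ℝ → ℝ} (hH : Monotone H)
    (hH01 : ∀ t, H t ∈ Icc (0:ℝ) 1) {A : Set ℝ} (hA : A.OrdConnected) :
    |(n:ℝ)⁻¹ * ∑ i, (clampUnit (d i).2 - H (f (d i).1)) * A.indicator (1 : ℝ → ℝ) (f (d i).1)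
      - ∫ p, (clampUnit p.2 - H (f p.1)) * A.indicator (1 : ℝ → ℝ) (f p.1) ∂P|
      ≤ uniformDeviation P (ratResidual f) d := by
  set B : ℕ → ℕ → Set ℝ := fun m k => A ∩ {t | ((k:ℝ) + 1) / m ≤ H t} with hBdef
  have hB : ∀ m k, (B m k).OrdConnected := fun m k =>
    hA.inter (ordConnected_Ici.preimage_mono hH)
  have hres : ∀ m k, Measurable (setResidual f A (B m k)) := fun m k =>
    measurable_setResidual hf hA.measurableSet (hB m k).measurableSet
  refine abs_deviation_le_of_tendsto P d
    (φ := fun m p => (m:ℝ)⁻¹ * ∑ k ∈ Finset.range m, setResidual f A (B m k) p)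
    (ψ := fun p => (clampUnit p.2 - H (f p.1)) * A.indicator (1 : ℝ → ℝ) (f p.1))
    (fun m => (Finset.measurable_sum _ fun k _ => hres m k).const_mul _) ?_ ?_ ?_
  · intro m p
    rw [abs_mul, abs_of_nonneg (by positivity), inv_mul_eq_div]
    refine div_le_one_of_le₀ ((Finset.abs_sum_le_sum_abs _ _).trans ?_) (by positivity)
    calc _ ≤ ∑ _k ∈ Finset.range m, (1:ℝ) :=
          Finset.sum_le_sum fun k _ => abs_setResidual_le f _ _ p
      _ = m := by simp
  · intro p
    have hfl := (tendsto_nat_floor_mul_div_atTop (hH01 (f p.1)).1).comp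
      (tendsto_natCast_atTop_atTop (R := ℝ))
    refine ((hfl.const_sub (clampUnit p.2)).mul_const
      (A.indicator (1 : ℝ → ℝ) (f p.1))).congr' ?_
    filter_upwards [Filter.eventually_gt_atTop 0] with m hm
    have hmR : (m:ℝ) ≠ 0 := by positivity
    have hsplit : ∀ k, setResidual f A (B m k) p = (clampUnit p.2
        - if ((k:ℝ) + 1) / m ≤ H (f p.1) then (1:ℝ) else 0) * A.indicator (1 : ℝ → ℝ) (f p.1) := by
      intro k
      by_cases h1 : f p.1 ∈ A <;> by_cases h2 : ((k:ℝ) + 1) / m ≤ H (f p.1) <;>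
        simp [setResidual, hBdef, h1, h2]
    simp only [hsplit, Function.comp_apply]
    rw [← Finset.sum_mul, Finset.sum_sub_distrib,
      sum_indicator_threshold_eq_floor (hH01 _).1 (hH01 _).2 hm, Finset.sum_const,
      Finset.card_range, nsmul_eq_mul]
    field_simp
  · filter_upwards [Filter.eventually_gt_atTop 0] with m hm
    have hmR : (0:ℝ) < m := by exact_mod_cast hm
    have hint : ∀ k, Integrable (setResidual f A (B m k)) P := fun k =>
      Integrable.of_bound (hres m k).aestronglyMeasurable 1
        (Filter.Eventually.of_forall (abs_setResidual_le f _ _))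
    rw [integral_const_mul, integral_finsetSum _ fun k _ => hint k, ← Finset.mul_sum,
      Finset.sum_comm, mul_left_comm, ← mul_sub, Finset.mul_sum, ← Finset.sum_sub_distrib, abs_mul,
      abs_of_pos (inv_pos.2 hmR), inv_mul_le_iff₀ hmR]
    refine (Finset.abs_sum_le_sum_abs _ _).trans ?_
    calc _ ≤ ∑ _k ∈ Finset.range m, uniformDeviation P (ratResidual f) d :=
          Finset.sum_le_sum fun k _ => abs_deviation_setResidual_le P d hf hA (hB m k)
      _ = m * uniformDeviation P (ratResidual f) d := by simp

lemma cutoffCEP_le_uniformDeviation (hY : ∀ᵐ p ∂P, p.2 ∈ Icc (0:ℝ) 1) (hf : Measurable f)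
    {H : ℝ → ℝ} (hH : Monotone H) (hH01 : ∀ t, H t ∈ Icc (0:ℝ) 1)
    (hmin : ∀ h : ℝ → ℝ, Monotone h → (∀ t, h t ∈ Icc (0:ℝ) 1) →
      (∑ i, ((d i).2 - H (f (d i).1)) ^ 2) ≤ ∑ i, ((d i).2 - h (f (d i).1)) ^ 2)
    (hd : ∀ i, (d i).2 ∈ Icc (0:ℝ) 1) :
    cutoffCEP P (fun x => H (f x)) ≤ uniformDeviation P (ratResidual f) d := by
  have : Nonempty {I : Set ℝ // I ⊆ Icc 0 1 ∧ I.OrdConnected} :=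
    ⟨⟨∅, empty_subset _, ordConnected_empty⟩⟩
  refine ciSup_le fun I => ?_
  have key := abs_deviation_monotone_residual_le P d hf hH hH01 (I.2.2.preimage_mono hH)
  have hind : ∀ t, (H ⁻¹' I.1).indicator (1 : ℝ → ℝ) t = I.1.indicator (1 : ℝ → ℝ) (H t) :=
    fun t => rfl
  have hzero : ∑ i, (clampUnit (d i).2 - H (f (d i).1))
      * (H ⁻¹' I.1).indicator (1 : ℝ → ℝ) (f (d i).1) = 0 := by
    simp only [hind, clampUnit_of_mem (hd _)]
    refine sum_residual_indicator_eq_zero (fun i => (d i).2) (fun i => H (f (d i).1)) hd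
      (fun i => hH01 _) (fun φ hφ hφ01 => ?_) I.1
    exact hmin (fun t => φ (H t)) (hφ.comp hH) fun t => hφ01 _ (hH01 t)
  have hint : ∫ p, (p.2 - H (f p.1)) * I.1.indicator (1 : ℝ → ℝ) (H (f p.1)) ∂P
      = ∫ p, (clampUnit p.2 - H (f p.1)) * (H ⁻¹' I.1).indicator (1 : ℝ → ℝ) (f p.1) ∂P := by
    refine integral_congr_ae ?_
    filter_upwards [hY] with p hp
    rw [clampUnit_of_mem hp, hind]
  rw [hzero, mul_zero, zero_sub, abs_neg] at key
  rwa [hint]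

end Residual

/-- Isotonic regression post-hoc calibration: if `h_n = hfit(data)` is, for every data
set, a monotone non-decreasing function `[0,1] → [0,1]` minimizing the empirical squared
error `Σᵢ (Yᵢ − h(f(Xᵢ)))²` over monotone non-decreasing `h`, then for i.i.d. data from
`P`, with probability at least `1 − δ`,
`Δ_Cutoff^P(h_n ∘ f) ≤ (30 + 2√(2·log(2/δ)))/√n`. -/
theorem isotonic_cutoff_bound {𝒳 : Type*} [MeasurableSpace 𝒳]
    (P : Measure (𝒳 × ℝ)) [IsProbabilityMeasure P]
    (hY : ∀ᵐ p ∂P, p.2 ∈ Icc (0:ℝ) 1)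
    (f : 𝒳 → ℝ) (hf : Measurable f) (hf01 : ∀ x, f x ∈ Icc (0:ℝ) 1)
    (n : ℕ) (hn : 0 < n)
    (hfit : (Fin n → 𝒳 × ℝ) → ℝ → ℝ)
    (hfit_mono : ∀ d, Monotone (hfit d))
    (hfit01 : ∀ d t, hfit d t ∈ Icc (0:ℝ) 1)
    (hfit_min : ∀ (d : Fin n → 𝒳 × ℝ) (h : ℝ → ℝ), Monotone h →
      (∀ t, h t ∈ Icc (0:ℝ) 1) →
      (∑ i, ((d i).2 - hfit d (f (d i).1))^2) ≤ ∑ i, ((d i).2 - h (f (d i).1))^2)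
    (δ : ℝ) (hδ : 0 < δ) :
    ENNReal.ofReal (1 - δ) ≤
      (Measure.pi fun _ : Fin n => P)
        {d | cutoffCEP P (fun x => hfit d (f x))
          ≤ (30 + 2 * Real.sqrt (2 * Real.log (2/δ))) / Real.sqrt n} := by
  rcases le_or_gt 1 δ with h1 | h1
  · simp [ENNReal.ofReal_of_nonpos (sub_nonpos.2 h1)]
  have hnR : (0:ℝ) < n := by exact_mod_cast hn
  have hr : 0 < √(n:ℝ) := Real.sqrt_pos.2 hnR
  have hr2 : √(n:ℝ) ^ 2 = n := Real.sq_sqrt hnR.le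
  set μ : Measure (Fin n → 𝒳 × ℝ) := Measure.pi fun _ => P with hμ
  set g := ratResidual f with hg
  have hgm : ∀ q, Measurable (g q) := fun q =>
    measurable_setResidual hf measurableSet_Ioc measurableSet_Ioc
  have hg1 : ∀ q p, |g q p| ≤ 1 := fun q => abs_setResidual_le f _ _
  have hmean : ∫ z, uniformDeviation P g z ∂μ ≤ 16 * √n / n :=
    integral_uniformDeviation_le P g hn hgm hg1 _ (exists_bound_signed_ratResidual f hn)
  have hmean' : 16 * √n / n ≤ 30 / √(n:ℝ) := by
    rw [div_le_div_iff₀ hnR hr]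
    nlinarith
  set L := Real.log (2 / δ) with hL
  have hLpos : 0 ≤ L := Real.log_nonneg (by rw [le_div_iff₀ hδ]; linarith)
  set t := 2 * √(2 * L) / √(n:ℝ) with ht
  set B := {z | t ≤ uniformDeviation P g z - ∫ z, uniformDeviation P g z ∂μ} with hBdef
  have hB : μ B ≤ ENNReal.ofReal δ := by
    rw [← ofReal_measureReal]
    refine ENNReal.ofReal_le_ofReal ((measureReal_uniformDeviation_ge_le P g hn hgm hg1
      (by positivity)).trans ?_)
    have he : -(n:ℝ) * t ^ 2 / 2 = -(4 * L) := by
      rw [ht, div_pow, mul_pow, Real.sq_sqrt (by positivity), hr2]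
      field_simp
      ring
    calc Real.exp (-n * t ^ 2 / 2) ≤ Real.exp (-L) := by
          rw [he]
          exact Real.exp_le_exp.2 (by linarith)
      _ = δ / 2 := by rw [Real.exp_neg, hL, Real.exp_log (by positivity), inv_div]
      _ ≤ δ := by linarith
  have hBm : MeasurableSet B :=
    measurableSet_le measurable_const ((measurable_uniformDeviation P g hgm).sub_const _)
  have hdata : ∀ᵐ d ∂μ, ∀ i, (d i).2 ∈ Icc (0:ℝ) 1 := by
    rw [ae_all_iff]
    exact fun i => (measurePreserving_eval (fun _ : Fin n => P) i).quasiMeasurePreserving.ae hY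
  calc ENNReal.ofReal (1 - δ) = 1 - ENNReal.ofReal δ := by
        rw [ENNReal.ofReal_sub _ hδ.le, ENNReal.ofReal_one]
    _ ≤ 1 - μ B := tsub_le_tsub_left hB _
    _ = μ Bᶜ := (prob_compl_eq_one_sub hBm).symm
    _ ≤ _ := by
        refine measure_mono_ae ?_
        filter_upwards [hdata] with d hd hdB
        have h2 : ¬t ≤ uniformDeviation P g d - ∫ z, uniformDeviation P g z ∂μ := hdB
        change cutoffCEP P (fun x => hfit d (f x)) ≤ _
        have h3 := cutoffCEP_le_uniformDeviation P d hY hf (hfit_mono d) (hfit01 d)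
          (hfit_min d) hd
        rw [add_div]
        linarith
end

section
/- Let (X₁,Y₁),…,(Xₙ,Yₙ) be i.i.d. from P with Y ∈ [0,1], let f: 𝒳 → [0,1] be a fixed measurable function, and let h̃_n: [0,1] → [0,1] be any monotone non-decreasing data-dependent post-processor (e.g., Platt scaling). Fix a user-specified tolerance ε_n > 0 and define h_n := h̃_n if Δ̂_Cutoff(h̃_n ∘ f) ≤ ε_n, and h_n :≡ (1/n)·Σ_{i=1}^n Y_i (the constant empirical mean) otherwise, where Δ̂_Cutoff(g) := sup over intervals I of |(1/n)·Σ_{i=1}^n (Y_i − g(X_i))·1{g(X_i) ∈ I}|. Then for any δ > 0, with probability at least 1 − δ: Δ_Cutoff^P(h_n ∘ f) ≤ (30 + 2√(2·log(2/δ)))/√n + ε_n. -/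
open MeasureTheory Set

/-- Empirical Cutoff Calibration Error of `g` on a sample of size `m`:
`sup over intervals I ⊆ [0,1] of |(1/m)·Σᵢ (Yᵢ − g(Xᵢ))·1{g(Xᵢ) ∈ I}|`. -/
noncomputable def empCutoff {𝒳 : Type*} (g : 𝒳 → ℝ) {m : ℕ} (data : Fin m → 𝒳 × ℝ) : ℝ :=
  ⨆ I : {I : Set ℝ // I ⊆ Icc 0 1 ∧ I.OrdConnected},
    |(m : ℝ)⁻¹ * ∑ i, ((data i).2 - g (data i).1) * I.1.indicator (1 : ℝ → ℝ) (g (data i).1)|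

/-- Exponential-moment form of **McDiarmid's inequality**: a bounded measurable function of `n`
independent variables, each of which changes it by at most `c`, is sub-Gaussian with variance
proxy `n c² / 4`. -/
theorem integral_exp_le_of_bounded_differences {α : Type*} [MeasurableSpace α] (P : Measure α)
    [IsProbabilityMeasure P] (c : ℝ) (n : ℕ) (F : (Fin n → α) → ℝ) (hF : Measurable F)
    (C : ℝ) (hC : ∀ d, |F d| ≤ C)
    (hdiff : ∀ i d x, |F (Function.update d i x) - F d| ≤ c) (l : ℝ) :
    ∫ d, Real.exp (l * (F d - ∫ d', F d' ∂Measure.pi fun _ => P)) ∂(Measure.pi fun _ => P)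
      ≤ Real.exp (l ^ 2 * (n * c ^ 2) / 8) := by
  induction n with
  | zero =>
    have : ∀ d : Fin 0 → α, F d = F Fin.elim0 := fun d => congrArg F (Subsingleton.elim _ _)
    simp [this]
  | succ n ih =>
    have : Nonempty α := (inferInstance : NeZero P).out |> fun h => by
      by_contra hne
      rw [not_nonempty_iff] at hne
      exact h (Measure.eq_zero_of_isEmpty P)
    set Q : Measure (Fin n → α) := Measure.pi fun _ => P with hQ
    have key := measurePreserving_piFinSuccAbove (fun _ : Fin (n + 1) => P) 0
    have key2 : ∀ g : (Fin (n + 1) → α) → ℝ, ∫ d, g d ∂(Measure.pi fun _ => P)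
        = ∫ p, g (Fin.cons p.1 p.2) ∂(P.prod Q) := by
      intro g
      rw [← key.integral_comp']
      refine integral_congr_ae (Filter.Eventually.of_forall fun d => ?_)
      simp [MeasurableEquiv.piFinSuccAbove, Fin.insertNthEquiv]
    have mcons : Measurable fun p : α × (Fin n → α) => (Fin.cons p.1 p.2 : Fin (n + 1) → α) := by
      refine measurable_pi_lambda _ fun i => ?_
      refine Fin.cases ?_ (fun j => ?_) i
      · simpa using measurable_fst
      · simpa [Function.comp_def] using (measurable_pi_apply j).comp measurable_snd
    set H : α × (Fin n → α) → ℝ := fun p => F (Fin.cons p.1 p.2) with hH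
    have mH : Measurable H := hF.comp mcons
    have iH : Integrable H (P.prod Q) :=
      Integrable.of_bound mH.aestronglyMeasurable C (.of_forall fun p => hC _)
    have iHx : ∀ x, Integrable (fun d => H (x, d)) Q := fun x =>
      Integrable.of_bound (mH.comp measurable_prodMk_left).aestronglyMeasurable C
        (.of_forall fun p => hC _)
    set G : α → ℝ := fun x => ∫ d, H (x, d) ∂Q with hG
    have mG : Measurable G := mH.stronglyMeasurable.integral_prod_right.measurable
    have hGC : ∀ x, |G x| ≤ C := fun x => by
      have := norm_integral_le_of_norm_le_const (μ := Q) (f := fun d => H (x, d)) (C := C)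
        (.of_forall fun p => hC _)
      simpa using this
    have hGd : ∀ x y, G x - G y ≤ c := fun x y => by
      rw [hG]
      simp only
      rw [← integral_sub (iHx x) (iHx y)]
      calc ∫ d, (H (x, d) - H (y, d)) ∂Q ≤ ∫ d, c ∂Q := by
            refine integral_mono ((iHx x).sub (iHx y)) (integrable_const _) fun d => ?_
            have := hdiff 0 (Fin.cons y d) x
            rw [Fin.update_cons_zero] at this
            exact (le_abs_self _).trans this
        _ = c := by simp
    have hGI : ∀ x, G x ∈ Icc (⨅ y, G y) ((⨅ y, G y) + c) := fun x => by
      have hb : BddBelow (range G) := ⟨-C, by rintro _ ⟨y, rfl⟩; exact (abs_le.1 (hGC y)).1⟩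
      refine ⟨ciInf_le hb x, ?_⟩
      rw [← sub_le_iff_le_add]
      exact le_ciInf fun y => by linarith [hGd x y]
    have hoeff := (ProbabilityTheory.hasSubgaussianMGF_of_mem_Icc (μ := P) mG.aemeasurable
      (.of_forall hGI)).mgf_le l
    have hEG : ∫ d, F d ∂(Measure.pi fun _ => P) = ∫ x, G x ∂P := by
      rw [key2, integral_prod _ iH]
    rw [key2, hEG]
    set m := ∫ x, G x ∂P with hm
    have hmC : |m| ≤ C := by
      have := norm_integral_le_of_norm_le_const (μ := P) (f := G) (C := C) (.of_forall hGC)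
      simpa using this
    have bexp : ∀ u v : ℝ, |u| ≤ C → |v| ≤ C → ‖Real.exp (l * (u - v))‖ ≤ Real.exp (|l| * (2 * C)) := by
      intro u v hu hv
      rw [Real.norm_eq_abs, Real.abs_exp]
      refine Real.exp_le_exp.2 ((le_abs_self _).trans ?_)
      rw [abs_mul]
      gcongr
      exact (abs_sub _ _).trans (by linarith)
    have iE : Integrable (fun p => Real.exp (l * (H p - m))) (P.prod Q) :=
      Integrable.of_bound (by fun_prop) _ (.of_forall fun p => bexp _ _ (hC _) hmC)
    rw [integral_prod _ iE]
    calc ∫ x, ∫ d, Real.exp (l * (H (x, d) - m)) ∂Q ∂P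
        ≤ ∫ x, Real.exp (l * (G x - m)) * Real.exp (l ^ 2 * (n * c ^ 2) / 8) ∂P := by
          refine integral_mono iE.integral_prod_left ?_ fun x => ?_
          · exact (Integrable.of_bound (by fun_prop) _
              (.of_forall fun x => bexp _ _ (hGC x) hmC)).mul_const _
          · have h1 := ih (fun d => H (x, d)) (mH.comp measurable_prodMk_left) (fun d => hC _)
              (fun i d y => by
                have := hdiff i.succ (Fin.cons x d) y
                rwa [← Fin.cons_update] at this)
            have h2 : ∀ d, Real.exp (l * (H (x, d) - m))
                = Real.exp (l * (G x - m)) * Real.exp (l * (H (x, d) - G x)) := fun d => by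
              rw [← Real.exp_add]; ring_nf
            simp only [h2, integral_const_mul]
            exact mul_le_mul_of_nonneg_left h1 (Real.exp_pos _).le
      _ = (∫ x, Real.exp (l * (G x - m)) ∂P) * Real.exp (l ^ 2 * (n * c ^ 2) / 8) :=
          integral_mul_const _ _
      _ ≤ Real.exp (l ^ 2 * c ^ 2 / 8) * Real.exp (l ^ 2 * (n * c ^ 2) / 8) := by
          refine mul_le_mul_of_nonneg_right (hoeff.trans (Real.exp_le_exp.2 (le_of_eq ?_)))
            (Real.exp_pos _).le
          simp [div_pow]
          ring
      _ = _ := by rw [← Real.exp_add]; push_cast; ring_nf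

/-- The sign vector equal to `-1` at `a` and `1` elsewhere. -/
def signFlip {n : ℕ} (a : Fin n) : Fin n → ℤˣ := Pi.mulSingle a (-1)

theorem sum_signFlip {n : ℕ} (a : Fin n) (g : (Fin n → ℤˣ) → ℝ) :
    ∑ σ, g (signFlip a * σ) = ∑ σ, g σ :=
  Equiv.sum_comp (Equiv.mulLeft (signFlip a)) g

theorem signedSum_signFlip {n : ℕ} {a : Fin n} {s : Finset (Fin n)} (ha : a ∉ s) (y : Fin n → ℝ)
    (σ : Fin n → ℤˣ) :
    ∑ i ∈ s, (((signFlip a * σ) i : ℤ) : ℝ) * y i = ∑ i ∈ s, ((σ i : ℤ) : ℝ) * y i := by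
  refine Finset.sum_congr rfl fun i hi => ?_
  have : i ≠ a := fun h => ha (h ▸ hi)
  simp [signFlip, Pi.mulSingle_eq_of_ne this]

/-- Doob's `L²` argument for the signed sums `∑_{i ∈ s, x i < q} σ i * y i`: they are dominated by
a function `M` of the signs in `s`, for which `M² - 2 |S| M` has nonpositive mean. -/
theorem exists_signedSum_majorant {n : ℕ} (x y : Fin n → ℝ) (s : Finset (Fin n)) :
    ∃ M : (Fin n → ℤˣ) → ℝ, (∀ σ, 0 ≤ M σ) ∧ (∀ a ∉ s, ∀ σ, M (signFlip a * σ) = M σ) ∧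
      (∀ (σ : Fin n → ℤˣ) (q : ℝ), |∑ i ∈ s with x i < q, ((σ i : ℤ) : ℝ) * y i| ≤ M σ) ∧
      ∑ σ : Fin n → ℤˣ, (M σ ^ 2 - 2 * |∑ i ∈ s, ((σ i : ℤ) : ℝ) * y i| * M σ) ≤ 0 ∧
      ∑ σ : Fin n → ℤˣ, (∑ i ∈ s, ((σ i : ℤ) : ℝ) * y i) ^ 2
        ≤ Fintype.card (Fin n → ℤˣ) * ∑ i ∈ s, y i ^ 2 := by
  induction s using Finset.induction_on_max_value x with
  | empty => exact ⟨fun _ => 0, by simp⟩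
  | insert a s ha hmax ih =>
    obtain ⟨M, M0, Mflip, Mle, Msum, Ssq⟩ := ih
    set S : (Fin n → ℤˣ) → ℝ := fun σ => ∑ i ∈ s, ((σ i : ℤ) : ℝ) * y i with hS
    set T : (Fin n → ℤˣ) → ℝ := fun σ => ∑ i ∈ insert a s, ((σ i : ℤ) : ℝ) * y i with hT
    have hTS : ∀ σ, T σ = ((σ a : ℤ) : ℝ) * y a + S σ := fun σ => Finset.sum_insert ha
    have hSf : ∀ σ, S (signFlip a * σ) = S σ := signedSum_signFlip ha y
    have hTf : ∀ σ, T (signFlip a * σ) = -(((σ a : ℤ) : ℝ) * y a) + S σ := fun σ => by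
      rw [hTS, hSf]; simp [signFlip]
    refine ⟨fun σ => max (M σ) |T σ|, fun σ => le_max_of_le_left (M0 σ), ?_, ?_, ?_, ?_⟩
    · intro b hb σ
      have hbs : b ∉ s := fun h => hb (Finset.mem_insert_of_mem h)
      simp only [Mflip b hbs]
      rw [hT]; simp only [signedSum_signFlip hb]
    · intro σ q
      by_cases hq : x a < q
      · refine le_max_of_le_right (le_of_eq ?_)
        rw [Finset.filter_true_of_mem]
        intro i hi
        rcases Finset.mem_insert.1 hi with rfl | hi
        · exact hq
        · exact (hmax i hi).trans_lt hq
      · refine le_max_of_le_left ?_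
        rw [Finset.filter_insert, if_neg hq]
        exact Mle σ q
    · have h1 : ∑ σ, |T σ| * M σ ≥ ∑ σ, |S σ| * M σ := by
        have h2 := sum_signFlip a fun σ => |T σ| * M σ
        have h3 : ∑ σ, 2 * (|S σ| * M σ) ≤
            ∑ σ, (|T (signFlip a * σ)| * M (signFlip a * σ) + |T σ| * M σ) := by
          refine Finset.sum_le_sum fun σ _ => ?_
          rw [Mflip a ha, hTf, hTS, ← add_mul, ← mul_assoc]
          refine mul_le_mul_of_nonneg_right ?_ (M0 σ)
          calc 2 * |S σ| = |2 * S σ| := by rw [abs_mul, abs_two]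
            _ = |(-(((σ a : ℤ) : ℝ) * y a) + S σ) + (((σ a : ℤ) : ℝ) * y a + S σ)| := by ring_nf
            _ ≤ _ := abs_add_le _ _
        rw [Finset.sum_add_distrib, h2, ← Finset.mul_sum] at h3
        linarith
      calc ∑ σ, (max (M σ) |T σ| ^ 2 - 2 * |T σ| * max (M σ) |T σ|)
          ≤ ∑ σ, (M σ ^ 2 - 2 * (|T σ| * M σ)) := by
            refine Finset.sum_le_sum fun σ _ => ?_
            rcases le_total (M σ) |T σ| with h | h
            · rw [max_eq_right h]; nlinarith [sq_nonneg (M σ - |T σ|)]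
            · rw [max_eq_left h]; linarith
        _ ≤ ∑ σ, (M σ ^ 2 - 2 * (|S σ| * M σ)) := by
            simp only [Finset.sum_sub_distrib, ← Finset.mul_sum]
            linarith
        _ ≤ 0 := by simpa only [mul_assoc] using Msum
    · have h2 := sum_signFlip a fun σ => T σ ^ 2
      have h3 : ∑ σ, T (signFlip a * σ) ^ 2 + ∑ σ, T σ ^ 2 = ∑ σ, (2 * S σ ^ 2 + 2 * y a ^ 2) := by
        rw [← Finset.sum_add_distrib]
        refine Finset.sum_congr rfl fun σ _ => ?_
        rw [hTf, hTS]
        rcases Int.units_eq_one_or (σ a) with h | h <;> simp [h] <;> ring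
      rw [Finset.sum_add_distrib, h2, ← Finset.mul_sum] at h3
      simp only [Finset.sum_const, Finset.card_univ, nsmul_eq_mul] at h3
      rw [Finset.sum_insert ha, mul_add]
      change ∑ σ, T σ ^ 2 ≤ _
      linarith

/-- The mean over all signs of the largest initial signed sum of `n` numbers in `[-1, 1]`
is at most `2 √n`. -/
theorem sum_iSup_signedSum_le {n : ℕ} (hn : 0 < n) (x y : Fin n → ℝ) (hy : ∀ i, |y i| ≤ 1) :
    ∑ σ : Fin n → ℤˣ, ⨆ q : ℚ, |∑ i with x i < (q : ℝ), ((σ i : ℤ) : ℝ) * y i|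
      ≤ Fintype.card (Fin n → ℤˣ) * (2 * √n) := by
  obtain ⟨M, M0, -, Mle, Msum, Ssq⟩ := exists_signedSum_majorant x y Finset.univ
  set N : ℝ := ((Fintype.card (Fin n → ℤˣ) : ℕ) : ℝ)
  set S : (Fin n → ℤˣ) → ℝ := fun σ => ∑ i, ((σ i : ℤ) : ℝ) * y i with hS
  have hr : 0 < √(n : ℝ) := Real.sqrt_pos.2 (by exact_mod_cast hn)
  have hr2 : √(n : ℝ) * √n = n := Real.mul_self_sqrt (by positivity)
  have hy2 : ∑ i, y i ^ 2 ≤ n := by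
    calc ∑ i, y i ^ 2 ≤ ∑ i : Fin n, (1 : ℝ) :=
          Finset.sum_le_sum fun i _ => by
            rw [← sq_abs]; exact pow_le_one₀ (abs_nonneg _) (hy i)
      _ = n := by simp
  have hS2 : ∑ σ, S σ ^ 2 ≤ N * n := Ssq.trans (by gcongr)
  have hM2 : ∑ σ, M σ ^ 2 ≤ 4 * (N * n) := by
    have : ∑ σ, M σ ^ 2 ≤ ∑ σ, (2 * (M σ ^ 2 - 2 * |S σ| * M σ) + 4 * S σ ^ 2) :=
      Finset.sum_le_sum fun σ _ => by
        nlinarith [sq_nonneg (M σ - 2 * |S σ|), sq_abs (S σ)]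
    rw [Finset.sum_add_distrib, ← Finset.mul_sum, ← Finset.mul_sum] at this
    linarith
  have hM : ∑ σ, 4 * √n * M σ ≤ ∑ σ, (M σ ^ 2 + 4 * n) :=
    Finset.sum_le_sum fun σ _ => by nlinarith [sq_nonneg (M σ - 2 * √n)]
  rw [← Finset.mul_sum, Finset.sum_add_distrib] at hM
  simp only [Finset.sum_const, Finset.card_univ, nsmul_eq_mul] at hM
  calc _ ≤ ∑ σ, M σ := Finset.sum_le_sum fun σ _ => ciSup_le fun q : ℚ => Mle σ q
    _ ≤ N * (2 * √n) := by
      refine le_of_mul_le_mul_left ?_ (by positivity : 0 < 4 * √(n : ℝ))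
      have : 4 * √(n : ℝ) * (N * (2 * √n)) = 8 * (N * n) := by
        linear_combination 8 * N * hr2
      rw [this]
      change _ ≤ _ + N * (4 * n) at hM
      linarith

theorem integral_empirical_mean {Z : Type*} [MeasurableSpace Z] (P : Measure Z)
    [IsProbabilityMeasure P] {n : ℕ} (hn : 0 < n) (g : Z → ℝ) (hg : Integrable g P) :
    ∫ d, (n : ℝ)⁻¹ * ∑ i, g (d i) ∂(Measure.pi fun _ : Fin n => P) = ∫ z, g z ∂P := by
  have h : ∀ i : Fin n, MeasurePreserving (fun d : Fin n → Z => d i) (Measure.pi fun _ => P) P :=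
    fun i => measurePreserving_eval (fun _ => P) i
  have h2 : ∀ i : Fin n, ∫ d, g (d i) ∂(Measure.pi fun _ : Fin n => P) = ∫ z, g z ∂P := fun i => by
    conv_rhs => rw [← (h i).map_eq]
    rw [integral_map (h i).measurable.aemeasurable]
    rw [(h i).map_eq]
    exact hg.aestronglyMeasurable
  rw [integral_const_mul, integral_finsetSum (f := fun i (d : Fin n → Z) => g (d i)) _ fun i _ =>
    (h i).integrable_comp_of_integrable hg]
  simp only [h2, Finset.sum_const, Finset.card_univ, Fintype.card_fin, nsmul_eq_mul]
  rw [inv_mul_cancel_left₀ (by positivity)]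

theorem abs_sum_le_card {n : ℕ} {u : Fin n → ℝ} {C : ℝ} (hu : ∀ i, |u i| ≤ C) :
    |∑ i, u i| ≤ n * C :=
  (Finset.abs_sum_le_sum_abs _ _).trans <| (Finset.sum_le_sum fun i _ => hu i).trans (by simp)

theorem abs_units_mul (u : ℤˣ) (x : ℝ) : |((u : ℤ) : ℝ) * x| = |x| := by
  rcases Int.units_eq_one_or u with h | h <;> simp [h]

theorem abs_iSup_abs_le {ι : Type*} [Nonempty ι] {u : ι → ℝ} {C : ℝ} (hu : ∀ q, |u q| ≤ C) :
    |(⨆ q, |u q|)| ≤ C := by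
  rw [abs_of_nonneg (Real.iSup_nonneg fun q => abs_nonneg _)]
  exact ciSup_le hu

theorem le_iSup_abs {ι : Type*} {u : ι → ℝ} {C : ℝ} (hu : ∀ q, |u q| ≤ C) (q : ι) :
    |u q| ≤ ⨆ q, |u q| :=
  le_ciSup (f := fun q => |u q|) ⟨C, by rintro _ ⟨q, rfl⟩; exact hu q⟩ q

/-- **Symmetrization**: the expected supremum of an empirical process is at most twice its
Rademacher complexity. -/
theorem integral_iSup_empirical_le {Z ι : Type*} [MeasurableSpace Z] [Countable ι] [Nonempty ι]
    (P : Measure Z) [IsProbabilityMeasure P] {n : ℕ} (hn : 0 < n) (g : ι → Z → ℝ)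
    (hg : ∀ q, Measurable (g q)) (hg1 : ∀ q z, |g q z| ≤ 1) (R : ℝ)
    (hR : ∀ d : Fin n → Z, ∑ σ : Fin n → ℤˣ, ⨆ q, |∑ i, ((σ i : ℤ) : ℝ) * g q (d i)|
      ≤ Fintype.card (Fin n → ℤˣ) * R) :
    ∫ d, ⨆ q, |(n : ℝ)⁻¹ * ∑ i, g q (d i) - ∫ z, g q z ∂P| ∂(Measure.pi fun _ : Fin n => P)
      ≤ (n : ℝ)⁻¹ * (2 * R) := by
  set Q : Measure (Fin n → Z) := Measure.pi fun _ => P with hQ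
  have hn' : (0 : ℝ) < n := by exact_mod_cast hn
  have ig : ∀ q, Integrable (g q) P := fun q =>
    Integrable.of_bound (hg q).aestronglyMeasurable 1 (.of_forall (hg1 q))
  have hsum : ∀ q (d : Fin n → Z), |(n : ℝ)⁻¹ * ∑ i, g q (d i)| ≤ 1 := fun q d => by
    rw [abs_mul, abs_inv, abs_of_pos hn', inv_mul_le_iff₀ hn']
    exact abs_sum_le_card fun i => hg1 q _
  have hmean : ∀ q, |∫ z, g q z ∂P| ≤ 1 := fun q => by
    simpa using norm_integral_le_of_norm_le_const (μ := P) (f := g q) (C := 1)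
      (.of_forall (hg1 q))
  have msum : ∀ q, Measurable fun d : Fin n → Z => (n : ℝ)⁻¹ * ∑ i, g q (d i) := fun q =>
    (Finset.measurable_sum _ fun i _ => (hg q).comp (measurable_pi_apply i)).const_mul _
  set K : (Fin n → Z) × (Fin n → Z) → ℝ := fun p =>
    ⨆ q, |(n : ℝ)⁻¹ * ∑ i, g q (p.1 i) - (n : ℝ)⁻¹ * ∑ i, g q (p.2 i)| with hK
  have bK : ∀ p : (Fin n → Z) × (Fin n → Z), ∀ q,
      |(n : ℝ)⁻¹ * ∑ i, g q (p.1 i) - (n : ℝ)⁻¹ * ∑ i, g q (p.2 i)| ≤ 2 := fun p q =>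
    (abs_sub _ _).trans (by linarith [hsum q p.1, hsum q p.2])
  have mK : Measurable K := Measurable.iSup fun q =>
    (((msum q).comp measurable_fst).sub ((msum q).comp measurable_snd)).abs
  have iK : Integrable K (Q.prod Q) := Integrable.of_bound mK.aestronglyMeasurable 2
    (.of_forall fun p => abs_iSup_abs_le (bK p))
  have step1 : ∫ d, ⨆ q, |(n : ℝ)⁻¹ * ∑ i, g q (d i) - ∫ z, g q z ∂P| ∂Q
      ≤ ∫ p, K p ∂(Q.prod Q) := by
    rw [integral_prod _ iK]
    refine integral_mono (Integrable.of_bound (Measurable.aestronglyMeasurable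
      (Measurable.iSup fun q => ((msum q).sub_const _).abs)) 2 (.of_forall fun d =>
        abs_iSup_abs_le fun q => ?_)) iK.integral_prod_left fun d => ciSup_le fun q => ?_
    · exact (abs_sub _ _).trans (by linarith [hsum q d, hmean q])
    · have i2 : Integrable (fun d' : Fin n → Z => (n : ℝ)⁻¹ * ∑ i, g q (d' i)) Q :=
        Integrable.of_bound (msum q).aestronglyMeasurable 1 (.of_forall (hsum q))
      have i3 : Integrable (fun d' : Fin n → Z =>
          (n : ℝ)⁻¹ * ∑ i, g q (d i) - (n : ℝ)⁻¹ * ∑ i, g q (d' i)) Q :=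
        (integrable_const _).sub i2
      have : (n : ℝ)⁻¹ * ∑ i, g q (d i) - ∫ z, g q z ∂P
          = ∫ d', ((n : ℝ)⁻¹ * ∑ i, g q (d i) - (n : ℝ)⁻¹ * ∑ i, g q (d' i)) ∂Q := by
        rw [integral_sub (integrable_const _) i2, integral_empirical_mean P hn _ (ig q)]
        simp
      rw [this]
      refine abs_integral_le_integral_abs.trans (integral_mono i3.abs
        (Integrable.of_bound (mK.comp measurable_prodMk_left).aestronglyMeasurable 2
          (.of_forall fun d' => abs_iSup_abs_le (bK (d, d')))) fun d' => ?_)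
      exact le_iSup_abs (bK (d, d')) q
  set V : Measure (Fin n → Z × Z) := Measure.pi fun _ => P.prod P with hV
  set K' : (Fin n → ℤˣ) → (Fin n → Z × Z) → ℝ := fun σ p =>
    ⨆ q, |(n : ℝ)⁻¹ * ∑ i, ((σ i : ℤ) : ℝ) * (g q (p i).1 - g q (p i).2)| with hK'
  have step2 : ∀ σ, ∫ p, K p ∂(Q.prod Q) = ∫ p, K' σ p ∂V := by
    intro σ
    rw [← (measurePreserving_arrowProdEquivProdArrow Z Z (Fin n) (fun _ => P)
      (fun _ => P)).integral_comp']
    have hsw := measurePreserving_pi (fun _ : Fin n => P.prod P) (fun _ => P.prod P)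
      (f := fun i => if σ i = 1 then id else Prod.swap) fun i => by
        split_ifs
        · exact MeasurePreserving.id _
        · exact Measure.measurePreserving_swap
    have mKe : Measurable fun p => K (MeasurableEquiv.arrowProdEquivProdArrow Z Z (Fin n) p) :=
      mK.comp (MeasurableEquiv.measurable _)
    rw [← hsw.map_eq, integral_map hsw.measurable.aemeasurable mKe.aestronglyMeasurable]
    refine integral_congr_ae (.of_forall fun p => ?_)
    refine iSup_congr fun q => ?_
    rw [← mul_sub, ← Finset.sum_sub_distrib]
    congr 2
    refine Finset.sum_congr rfl fun i _ => ?_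
    simp only [MeasurableEquiv.arrowProdEquivProdArrow, MeasurableEquiv.coe_mk,
      Equiv.arrowProdEquivProdArrow, Equiv.coe_fn_mk]
    rcases Int.units_eq_one_or (σ i) with h | h <;> simp [h]
  have bR : ∀ (σ : Fin n → ℤˣ) (d : Fin n → Z) q,
      |∑ i, ((σ i : ℤ) : ℝ) * g q (d i)| ≤ n * 1 := fun σ d q =>
    abs_sum_le_card fun i => by rw [abs_units_mul]; exact hg1 q _
  have bK' : ∀ (σ : Fin n → ℤˣ) (p : Fin n → Z × Z) q,
      |(n : ℝ)⁻¹ * ∑ i, ((σ i : ℤ) : ℝ) * (g q (p i).1 - g q (p i).2)| ≤ 2 := by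
    intro σ p q
    rw [abs_mul, abs_inv, abs_of_pos hn', inv_mul_le_iff₀ hn']
    refine abs_sum_le_card fun i => ?_
    rw [abs_units_mul]
    exact (abs_sub _ _).trans (by linarith [hg1 q (p i).1, hg1 q (p i).2])
  have iK' : ∀ σ, Integrable (K' σ) V := fun σ => by
    refine Integrable.of_bound (Measurable.aestronglyMeasurable (Measurable.iSup fun q => ?_)) 2
      (.of_forall fun p => abs_iSup_abs_le (bK' σ p))
    have := hg q
    fun_prop
  have step3 : ∀ p, ∑ σ, K' σ p ≤ Fintype.card (Fin n → ℤˣ) * ((n : ℝ)⁻¹ * (2 * R)) := by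
    intro p
    have h : ∀ σ, K' σ p ≤ (n : ℝ)⁻¹ * ((⨆ q, |∑ i, ((σ i : ℤ) : ℝ) * g q (p i).1|)
        + ⨆ q, |∑ i, ((σ i : ℤ) : ℝ) * g q (p i).2|) := by
      refine fun σ => ciSup_le fun q => ?_
      rw [abs_mul, abs_inv, abs_of_pos hn']
      refine mul_le_mul_of_nonneg_left ?_ (by positivity)
      simp only [mul_sub, Finset.sum_sub_distrib]
      exact (abs_sub _ _).trans (add_le_add (le_iSup_abs (bR σ fun i => (p i).1) q)
        (le_iSup_abs (bR σ fun i => (p i).2) q))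
    refine (Finset.sum_le_sum fun σ _ => h σ).trans ?_
    rw [← Finset.mul_sum, Finset.sum_add_distrib, mul_left_comm]
    refine mul_le_mul_of_nonneg_left ?_ (by positivity)
    linarith [hR fun i => (p i).1, hR fun i => (p i).2]
  refine step1.trans ?_
  have hcard : (0 : ℝ) < Fintype.card (Fin n → ℤˣ) := by exact_mod_cast Fintype.card_pos
  refine le_of_mul_le_mul_left ?_ hcard
  calc (Fintype.card (Fin n → ℤˣ) : ℝ) * ∫ p, K p ∂(Q.prod Q)
      = ∑ σ : Fin n → ℤˣ, ∫ p, K' σ p ∂V := by simp [← step2]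
    _ = ∫ p, ∑ σ, K' σ p ∂V := (integral_finsetSum _ fun σ _ => iK' σ).symm
    _ ≤ ∫ p, Fintype.card (Fin n → ℤˣ) * ((n : ℝ)⁻¹ * (2 * R)) ∂V :=
      integral_mono (integrable_finsetSum _ fun σ _ => iK' σ) (integrable_const _) step3
    _ = _ := by simp

/-- Tail bound for the supremum of an empirical process indexed by `[0, 1]`-valued functions. -/
theorem measure_exists_empirical_gt_le {Z ι : Type*} [MeasurableSpace Z] [Countable ι] [Nonempty ι]
    (P : Measure Z) [IsProbabilityMeasure P] {n : ℕ} (hn : 0 < n) (g : ι → Z → ℝ)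
    (hg : ∀ q, Measurable (g q)) (hg1 : ∀ q z, g q z ∈ Icc (0 : ℝ) 1) (R : ℝ)
    (hR : ∀ d : Fin n → Z, ∑ σ : Fin n → ℤˣ, ⨆ q, |∑ i, ((σ i : ℤ) : ℝ) * g q (d i)|
      ≤ Fintype.card (Fin n → ℤˣ) * R) (t : ℝ) (ht : 0 ≤ t) :
    (Measure.pi fun _ : Fin n => P)
      {d | ∃ q, (n : ℝ)⁻¹ * (2 * R) + t < |(n : ℝ)⁻¹ * ∑ i, g q (d i) - ∫ z, g q z ∂P|}
      ≤ ENNReal.ofReal (Real.exp (-2 * n * t ^ 2)) := by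
  set Q : Measure (Fin n → Z) := Measure.pi fun _ => P with hQ
  have hn' : (0 : ℝ) < n := by exact_mod_cast hn
  have hga : ∀ q z, |g q z| ≤ 1 := fun q z => abs_le.2 ⟨by linarith [(hg1 q z).1], (hg1 q z).2⟩
  have hsum : ∀ q (d : Fin n → Z), |(n : ℝ)⁻¹ * ∑ i, g q (d i)| ≤ 1 := fun q d => by
    rw [abs_mul, abs_inv, abs_of_pos hn', inv_mul_le_iff₀ hn']
    exact abs_sum_le_card fun i => hga q _
  have hmean : ∀ q, |∫ z, g q z ∂P| ≤ 1 := fun q => by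
    simpa using norm_integral_le_of_norm_le_const (μ := P) (f := g q) (C := 1)
      (.of_forall (hga q))
  have msum : ∀ q, Measurable fun d : Fin n → Z => (n : ℝ)⁻¹ * ∑ i, g q (d i) := fun q =>
    (Finset.measurable_sum _ fun i _ => (hg q).comp (measurable_pi_apply i)).const_mul _
  set F : (Fin n → Z) → ℝ := fun d => ⨆ q, |(n : ℝ)⁻¹ * ∑ i, g q (d i) - ∫ z, g q z ∂P| with hF
  have bF : ∀ d q, |(n : ℝ)⁻¹ * ∑ i, g q ((d : Fin n → Z) i) - ∫ z, g q z ∂P| ≤ 2 := fun d q =>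
    (abs_sub _ _).trans (by linarith [hsum q d, hmean q])
  have mF : Measurable F := Measurable.iSup fun q => ((msum q).sub_const _).abs
  have bF' : ∀ d, |F d| ≤ 2 := fun d => abs_iSup_abs_le (bF d)
  have hone : ∀ d d' : Fin n → Z, (∃ i x, d' = Function.update d i x) → F d' ≤ F d + (n : ℝ)⁻¹ := by
    rintro d _ ⟨i, x, rfl⟩
    refine ciSup_le fun q => ?_
    have h1 : ∑ j, g q (Function.update d i x j) - ∑ j, g q (d j) = g q x - g q (d i) := by
      rw [← Finset.sum_sub_distrib, Finset.sum_eq_single i]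
      · simp
      · intro j _ hj; simp [hj]
      · simp
    have h2 : |g q x - g q (d i)| ≤ 1 := abs_sub_le_iff.2
      ⟨by linarith [(hg1 q x).2, (hg1 q (d i)).1], by linarith [(hg1 q x).1, (hg1 q (d i)).2]⟩
    have h3 : (n : ℝ)⁻¹ * ∑ j, g q (Function.update d i x j) - ∫ z, g q z ∂P
        = ((n : ℝ)⁻¹ * ∑ j, g q (d j) - ∫ z, g q z ∂P) + (n : ℝ)⁻¹ * (g q x - g q (d i)) := by
      rw [← h1]; ring
    rw [h3]
    refine (abs_add_le _ _).trans (add_le_add (le_iSup_abs (bF d) q) ?_)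
    rw [abs_mul, abs_inv, abs_of_pos hn']
    exact mul_le_of_le_one_right (by positivity) h2
  have hdiff : ∀ i d x, |F (Function.update d i x) - F d| ≤ (n : ℝ)⁻¹ := fun i d x => by
    refine abs_sub_le_iff.2 ⟨by linarith [hone d _ ⟨i, x, rfl⟩], ?_⟩
    linarith [hone (Function.update d i x) d ⟨i, d i, by simp⟩]
  have hE : ∫ d, F d ∂Q ≤ (n : ℝ)⁻¹ * (2 * R) := integral_iSup_empirical_le P hn g hg hga R hR
  have hmgf := integral_exp_le_of_bounded_differences P _ n F mF 2 bF' hdiff (4 * n * t)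
  have hcher := ProbabilityTheory.measure_ge_le_exp_mul_mgf (μ := Q)
    (X := fun d => F d - ∫ d', F d' ∂Q) (t := 4 * n * t) t (by positivity) (by
      refine Integrable.of_bound (by fun_prop) (Real.exp (4 * n * t * (2 - ∫ d', F d' ∂Q)))
        (.of_forall fun d => ?_)
      rw [Real.norm_eq_abs, Real.abs_exp]
      refine Real.exp_le_exp.2 (mul_le_mul_of_nonneg_left ?_ (by positivity))
      linarith [le_abs_self (F d), bF' d])
  have hle : Q.real {d | t ≤ F d - ∫ d', F d' ∂Q} ≤ Real.exp (-2 * n * t ^ 2) := by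
    refine (hcher.trans (mul_le_mul_of_nonneg_left hmgf (Real.exp_pos _).le)).trans (le_of_eq ?_)
    rw [← Real.exp_add]
    congr 1
    field_simp
    ring
  refine (measure_mono ?_).trans (ENNReal.le_ofReal_iff_toReal_le (measure_ne_top _ _)
    (Real.exp_pos _).le |>.2 hle)
  rintro d ⟨q, hq⟩
  change t ≤ F d - ∫ d', F d' ∂Q
  linarith [le_iSup_abs (bF d) q]

/-- Tail bound for the deviation of weighted empirical distribution functions. -/
theorem measure_exists_threshold_gt_le {Z : Type*} [MeasurableSpace Z] (P : Measure Z)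
    [IsProbabilityMeasure P] {n : ℕ} (hn : 0 < n) (φ w : Z → ℝ) (hφ : Measurable φ)
    (hw : Measurable w) (hw1 : ∀ z, w z ∈ Icc (0 : ℝ) 1) (t : ℝ) (ht : 0 ≤ t) :
    (Measure.pi fun _ : Fin n => P)
      {d | ∃ q : ℚ, (n : ℝ)⁻¹ * (2 * (2 * √n)) + t <
        |(n : ℝ)⁻¹ * ∑ i, (φ ⁻¹' Iio (q : ℝ)).indicator w (d i)
          - ∫ z, (φ ⁻¹' Iio (q : ℝ)).indicator w z ∂P|}
      ≤ ENNReal.ofReal (Real.exp (-2 * n * t ^ 2)) := by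
  refine measure_exists_empirical_gt_le P hn (fun (q : ℚ) => (φ ⁻¹' Iio (q : ℝ)).indicator w)
    (fun q => hw.indicator (hφ measurableSet_Iio)) (fun q z => ?_) _ (fun d => ?_) t ht
  · by_cases h : z ∈ φ ⁻¹' Iio (q : ℝ)
    · simpa [h] using hw1 z
    · simp [h]
  · refine le_trans (le_of_eq ?_) (sum_iSup_signedSum_le hn (fun i => φ (d i)) (fun i => w (d i))
      fun i => abs_le.2 ⟨by linarith [(hw1 (d i)).1], (hw1 (d i)).2⟩)
    simp [Finset.sum_filter, Set.indicator]

theorem exists_rat_seq_eventually_lt_iff {L : Set ℝ} (hL : IsLowerSet L) :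
    ∃ u : ℕ → ℚ, ∀ x, ∀ᶠ k in Filter.atTop, (x < (u k : ℝ) ↔ x ∈ L) := by
  rcases L.eq_empty_or_nonempty with rfl | hne
  · refine ⟨fun k => -(k : ℚ), fun x => ?_⟩
    filter_upwards [Filter.eventually_ge_atTop ⌈-x⌉₊] with k hk
    have := Nat.ceil_le.1 hk
    simp only [mem_empty_iff_false, iff_false, not_lt]
    push_cast
    linarith
  by_cases huniv : L = univ
  · refine ⟨fun k => (k : ℚ), fun x => ?_⟩
    filter_upwards [Filter.eventually_gt_atTop ⌈x⌉₊] with k hk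
    have : x < k := (Nat.le_ceil x).trans_lt (by exact_mod_cast hk)
    simp [huniv, this]
  obtain ⟨b, hb⟩ := (ne_univ_iff_exists_notMem L).1 huniv
  have hbdd : BddAbove L := ⟨b, fun x hx => le_of_not_gt fun h => hb (hL h.le hx)⟩
  by_cases ha : sSup L ∈ L
  · obtain ⟨u, -, hu, hlim⟩ := Real.exists_seq_rat_strictAnti_tendsto (sSup L)
    refine ⟨u, fun x => ?_⟩
    rcases le_or_gt x (sSup L) with hx | hx
    · exact .of_forall fun k => iff_of_true (hx.trans_lt (hu k)) (hL hx ha)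
    · filter_upwards [hlim.eventually_lt_const hx] with k hk
      exact iff_of_false hk.le.not_gt fun h => (le_csSup hbdd h).not_gt hx
  · obtain ⟨u, -, hu, hlim⟩ := Real.exists_seq_rat_strictMono_tendsto (sSup L)
    refine ⟨u, fun x => ?_⟩
    rcases lt_or_ge x (sSup L) with hx | hx
    · filter_upwards [hlim.eventually_const_lt hx] with k hk
      obtain ⟨y, hy, hxy⟩ := exists_lt_of_lt_csSup hne hx
      exact iff_of_true hk (hL hxy.le hy)
    · refine .of_forall fun k => iff_of_false ((hu k).le.trans hx).not_gt fun h => ha ?_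
      exact (le_antisymm (le_csSup hbdd h) hx) ▸ h

theorem tendsto_integral_indicator_Iio {Z : Type*} [MeasurableSpace Z] (P : Measure Z)
    [IsFiniteMeasure P] {φ w : Z → ℝ} (hφ : Measurable φ) (hw : Integrable w P) {L : Set ℝ}
    {u : ℕ → ℚ} (hu : ∀ x, ∀ᶠ k in Filter.atTop, (x < (u k : ℝ) ↔ x ∈ L)) :
    Filter.Tendsto (fun k => ∫ z, (φ ⁻¹' Iio (u k : ℝ)).indicator w z ∂P) Filter.atTop
      (nhds (∫ z, (φ ⁻¹' L).indicator w z ∂P)) := by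
  refine tendsto_integral_of_dominated_convergence (fun z => ‖w z‖)
    (fun k => (hw.indicator (hφ measurableSet_Iio)).aestronglyMeasurable) hw.norm
    (fun k => .of_forall fun z => norm_indicator_le_norm_self _ _) (.of_forall fun z => ?_)
  refine tendsto_const_nhds.congr' ?_
  filter_upwards [hu (φ z)] with k hk
  by_cases hz : φ z ∈ L
  · simp [hz, hk.2 hz]
  · simp [hz, mt hk.1 hz]

/-- A uniform bound over half-lines gives twice that bound over intervals. -/
theorem abs_integral_indicator_sub_le {Z : Type*} [MeasurableSpace Z] (P Q : Measure Z)
    [IsFiniteMeasure P] [IsFiniteMeasure Q] {φ w : Z → ℝ} (hφ : Measurable φ)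
    (hP : Integrable w P) (hQ : Integrable w Q) {B : ℝ}
    (hB : ∀ q : ℚ, |∫ z, (φ ⁻¹' Iio (q : ℝ)).indicator w z ∂Q
      - ∫ z, (φ ⁻¹' Iio (q : ℝ)).indicator w z ∂P| ≤ B) {J : Set ℝ} (hJ : J.OrdConnected) :
    |∫ z, (φ ⁻¹' J).indicator w z ∂Q - ∫ z, (φ ⁻¹' J).indicator w z ∂P| ≤ 2 * B := by
  have hlow : ∀ L : Set ℝ, IsLowerSet L →
      |∫ z, (φ ⁻¹' L).indicator w z ∂Q - ∫ z, (φ ⁻¹' L).indicator w z ∂P| ≤ B := by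
    intro L hL
    obtain ⟨u, hu⟩ := exists_rat_seq_eventually_lt_iff hL
    exact le_of_tendsto' ((tendsto_integral_indicator_Iio Q hφ hQ hu).sub
      (tendsto_integral_indicator_Iio P hφ hP hu)).abs fun k => hB (u k)
  set L : Set ℝ := ↑(lowerClosure J) with hLdef
  have hL : IsLowerSet L := (lowerClosure J).lower
  have hL' : IsLowerSet (L \ J) := by
    rintro a b hba ⟨haL, haJ⟩
    refine ⟨hL hba haL, fun hb => haJ ?_⟩
    obtain ⟨c, hc, hac⟩ := haL
    exact hJ.out hb hc ⟨hba, hac⟩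
  have hsplit : ∀ z, (φ ⁻¹' J).indicator w z
      = (φ ⁻¹' L).indicator w z - (φ ⁻¹' (L \ J)).indicator w z := by
    intro z
    have : φ z ∈ J → φ z ∈ L := fun h => subset_lowerClosure h
    by_cases h1 : φ z ∈ J <;> by_cases h2 : φ z ∈ L <;> simp_all
  have hint : ∀ (μ : Measure Z) (L : Set ℝ), Integrable w μ → IsLowerSet L →
      Integrable ((φ ⁻¹' L).indicator w) μ := fun μ L h hL =>
    h.indicator (hφ hL.ordConnected.measurableSet)
  simp only [hsplit]
  rw [integral_sub (hint Q _ hQ hL) (hint Q _ hQ hL'), integral_sub (hint P _ hP hL) (hint P _ hP hL')]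
  have h1 := abs_le.1 (hlow _ hL)
  have h2 := abs_le.1 (hlow _ hL')
  exact abs_le.2 ⟨by linarith, by linarith⟩

theorem abs_integral_monotone_indicator_sub_le {Z : Type*} [MeasurableSpace Z] (P Q : Measure Z)
    [IsProbabilityMeasure P] [IsProbabilityMeasure Q] {φ : Z → ℝ} (hφ : Measurable φ) {B : ℝ}
    (hB : ∀ q : ℚ, |∫ z, (φ ⁻¹' Iio (q : ℝ)).indicator 1 z ∂Q
      - ∫ z, (φ ⁻¹' Iio (q : ℝ)).indicator 1 z ∂P| ≤ B) {h : ℝ → ℝ} (hh : Monotone h)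
    (hh1 : ∀ x, h x ∈ Icc (0 : ℝ) 1) {J : Set ℝ} (hJ : J.OrdConnected) :
    |∫ z, (φ ⁻¹' J).indicator (fun z => h (φ z)) z ∂Q
      - ∫ z, (φ ⁻¹' J).indicator (fun z => h (φ z)) z ∂P| ≤ 2 * B := by
  set ψ : Z → ℝ := (φ ⁻¹' J).indicator (fun z => h (φ z)) with hψ
  have mψ : Measurable ψ := (hh.measurable.comp hφ).indicator (hφ hJ.measurableSet)
  have ψ01 : ∀ z, ψ z ∈ Icc (0 : ℝ) 1 := fun z => by
    by_cases hz : z ∈ φ ⁻¹' J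
    · simpa [hψ, hz] using hh1 (φ z)
    · simp [hψ, hz]
  have hlayer : ∀ μ : Measure Z, IsProbabilityMeasure μ →
      ∫ z, ψ z ∂μ = ∫ t in Ioc 0 1, μ.real {z | t ≤ ψ z} := fun μ _ =>
    (Integrable.of_mem_Icc 0 1 mψ.aemeasurable (.of_forall ψ01)).integral_eq_integral_Ioc_meas_le
      (.of_forall fun z => (ψ01 z).1) (.of_forall fun z => (ψ01 z).2)
  have hint : ∀ μ : Measure Z, IsProbabilityMeasure μ →
      Integrable (fun t => μ.real {z | t ≤ ψ z}) (volume.restrict (Ioc (0 : ℝ) 1)) := by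
    intro μ _
    have anti : Antitone fun t => μ.real {z | t ≤ ψ z} := fun s t hst =>
      measureReal_mono fun z hz => le_trans hst hz
    refine Integrable.of_bound anti.measurable.aestronglyMeasurable 1 (.of_forall fun t => ?_)
    rw [Real.norm_eq_abs, abs_of_nonneg measureReal_nonneg]
    exact measureReal_le_one
  have hlevel : ∀ t ∈ Ioc (0 : ℝ) 1,
      {z | t ≤ ψ z} = φ ⁻¹' (J ∩ h ⁻¹' Ici t) := fun t ht => by
    ext z
    by_cases hz : φ z ∈ J
    · simp [hψ, hz]
    · simp [hψ, hz, ht.1]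
  rw [hlayer Q inferInstance, hlayer P inferInstance,
    ← integral_sub (hint Q inferInstance) (hint P inferInstance)]
  have := norm_setIntegral_le_of_norm_le_const (μ := volume) (s := Ioc (0 : ℝ) 1)
    (f := fun t => Q.real {z | t ≤ ψ z} - P.real {z | t ≤ ψ z}) (C := 2 * B) (by simp)
    fun t ht => by
      have ho : (J ∩ h ⁻¹' Ici t).OrdConnected := hJ.inter (ordConnected_Ici.preimage_mono hh)
      have hm : MeasurableSet (φ ⁻¹' (J ∩ h ⁻¹' Ici t)) := hφ ho.measurableSet
      have := abs_integral_indicator_sub_le P Q hφ (integrable_const 1) (integrable_const 1) hB ho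
      rw [Real.norm_eq_abs, hlevel t ht, ← integral_indicator_one hm, ← integral_indicator_one hm]
      exact this
  simpa using this

theorem integral_empirical_measure {Z : Type*} [MeasurableSpace Z] {n : ℕ} (d : Fin n → Z)
    {g : Z → ℝ} (hg : Measurable g) :
    ∫ z, g z ∂((n : ENNReal)⁻¹ • ∑ i, Measure.dirac (d i)) = (n : ℝ)⁻¹ * ∑ i, g (d i) := by
  rw [integral_smul_measure, integral_finsetSum_measure]
  · simp [integral_dirac' _ _ hg.stronglyMeasurable]
  · exact fun i _ => integrable_dirac' hg.stronglyMeasurable (by simp)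

theorem isProbabilityMeasure_empirical {Z : Type*} [MeasurableSpace Z] {n : ℕ} (hn : 0 < n)
    (d : Fin n → Z) :
    IsProbabilityMeasure ((n : ENNReal)⁻¹ • ∑ i, Measure.dirac (d i)) :=
  ⟨by simp [ENNReal.inv_mul_cancel, hn.ne']⟩

/-- If the empirical distribution functions of `φ`, unweighted and weighted by `w`, are within `B`
of their means, then so are all residuals of monotone functions of `φ` on intervals, up to a
factor of four. -/
theorem abs_empirical_residual_sub_le {Z : Type*} [MeasurableSpace Z] (P : Measure Z)
    [IsProbabilityMeasure P] {n : ℕ} (hn : 0 < n) (d : Fin n → Z) {φ w : Z → ℝ}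
    (hφ : Measurable φ) (hw : Measurable w) (hw1 : ∀ z, w z ∈ Icc (0 : ℝ) 1) {B : ℝ}
    (hBw : ∀ q : ℚ, |(n : ℝ)⁻¹ * ∑ i, (φ ⁻¹' Iio (q : ℝ)).indicator w (d i)
      - ∫ z, (φ ⁻¹' Iio (q : ℝ)).indicator w z ∂P| ≤ B)
    (hB1 : ∀ q : ℚ, |(n : ℝ)⁻¹ * ∑ i, (φ ⁻¹' Iio (q : ℝ)).indicator 1 (d i)
      - ∫ z, (φ ⁻¹' Iio (q : ℝ)).indicator 1 z ∂P| ≤ B)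
    {h : ℝ → ℝ} (hh : Monotone h) (hh1 : ∀ x, h x ∈ Icc (0 : ℝ) 1)
    {J : Set ℝ} (hJ : J.OrdConnected) :
    |(n : ℝ)⁻¹ * ∑ i, (w (d i) - h (φ (d i))) * J.indicator 1 (φ (d i))
      - ∫ z, (w z - h (φ z)) * J.indicator 1 (φ z) ∂P| ≤ 4 * B := by
  set Q : Measure Z := (n : ENNReal)⁻¹ • ∑ i, Measure.dirac (d i) with hQ
  have : IsProbabilityMeasure Q := isProbabilityMeasure_empirical hn d
  have hmeas : ∀ q : ℚ, MeasurableSet (φ ⁻¹' Iio (q : ℝ)) := fun q => hφ measurableSet_Iio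
  have hmJ : MeasurableSet (φ ⁻¹' J) := hφ hJ.measurableSet
  have mhφ : Measurable fun z => h (φ z) := hh.measurable.comp hφ
  have iw : ∀ μ : Measure Z, IsProbabilityMeasure μ → Integrable w μ := fun μ _ =>
    Integrable.of_mem_Icc 0 1 hw.aemeasurable (.of_forall hw1)
  have ih : ∀ μ : Measure Z, IsProbabilityMeasure μ → Integrable (fun z => h (φ z)) μ := fun μ _ =>
    Integrable.of_mem_Icc 0 1 mhφ.aemeasurable (.of_forall fun z => hh1 _)
  have h1 := abs_integral_indicator_sub_le P Q hφ (iw P inferInstance) (iw Q inferInstance)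
    (fun q => by rw [integral_empirical_measure d (hw.indicator (hmeas q))]; exact hBw q) hJ
  have h2 := abs_integral_monotone_indicator_sub_le P Q hφ
    (fun q => by
      rw [integral_empirical_measure d (measurable_one.indicator (hmeas q))]; exact hB1 q) hh hh1 hJ
  have hpt : ∀ z, (w z - h (φ z)) * J.indicator 1 (φ z)
      = (φ ⁻¹' J).indicator w z - (φ ⁻¹' J).indicator (fun z => h (φ z)) z := fun z => by
    by_cases hz : φ z ∈ J <;> simp [hz]
  simp only [hpt]
  rw [← integral_empirical_measure (g := fun z => (φ ⁻¹' J).indicator w z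
      - (φ ⁻¹' J).indicator (fun z => h (φ z)) z) d ((hw.indicator hmJ).sub (mhφ.indicator hmJ)),
    integral_sub ((iw Q inferInstance).indicator hmJ) ((ih Q inferInstance).indicator hmJ),
    integral_sub ((iw P inferInstance).indicator hmJ) ((ih P inferInstance).indicator hmJ)]
  have h1 := abs_le.1 h1
  have h2 := abs_le.1 h2
  exact abs_le.2 ⟨by linarith, by linarith⟩

theorem abs_inv_mul_residual_sum_le {𝒳 : Type*} (g : 𝒳 → ℝ) {n : ℕ} (d : Fin n → 𝒳 × ℝ)
    (I : Set ℝ) :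
    |(n : ℝ)⁻¹ * ∑ i, ((d i).2 - g (d i).1) * I.indicator (1 : ℝ → ℝ) (g (d i).1)|
      ≤ (n : ℝ)⁻¹ * ∑ i, |(d i).2 - g (d i).1| := by
  rw [abs_mul, abs_inv, Nat.abs_cast]
  refine mul_le_mul_of_nonneg_left ((Finset.abs_sum_le_sum_abs _ _).trans
    (Finset.sum_le_sum fun i _ => ?_)) (by positivity)
  by_cases h : g (d i).1 ∈ I <;> simp [h]

theorem le_empCutoff {𝒳 : Type*} (g : 𝒳 → ℝ) {n : ℕ} (d : Fin n → 𝒳 × ℝ) {I : Set ℝ}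
    (hI : I ⊆ Icc 0 1) (hI' : I.OrdConnected) :
    |(n : ℝ)⁻¹ * ∑ i, ((d i).2 - g (d i).1) * I.indicator (1 : ℝ → ℝ) (g (d i).1)|
      ≤ empCutoff g d :=
  le_ciSup (f := fun I : {I : Set ℝ // I ⊆ Icc 0 1 ∧ I.OrdConnected} =>
      |(n : ℝ)⁻¹ * ∑ i, ((d i).2 - g (d i).1) * I.1.indicator (1 : ℝ → ℝ) (g (d i).1)|)
    ⟨_, by rintro _ ⟨J, rfl⟩; exact abs_inv_mul_residual_sum_le g d J.1⟩ ⟨I, hI, hI'⟩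

/-- The constant empirical mean has zero empirical cutoff calibration error. -/
theorem empCutoff_mean_le {𝒳 : Type*} {n : ℕ} (hn : 0 < n) (d : Fin n → 𝒳 × ℝ) :
    empCutoff (fun _ => (n : ℝ)⁻¹ * ∑ i, (d i).2) d ≤ 0 := by
  have : Nonempty {I : Set ℝ // I ⊆ Icc 0 1 ∧ I.OrdConnected} :=
    ⟨∅, empty_subset _, ordConnected_empty⟩
  refine ciSup_le fun I => le_of_eq ?_
  have hn' : (n : ℝ) ≠ 0 := by exact_mod_cast hn.ne'
  rw [← Finset.sum_mul, Finset.sum_sub_distrib]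
  simp only [Finset.sum_const, Finset.card_univ, Fintype.card_fin, nsmul_eq_mul]
  rw [mul_inv_cancel_left₀ hn', sub_self]
  simp

theorem cutoffCEP_le_empCutoff_add {𝒳 : Type*} [MeasurableSpace 𝒳] (P : Measure (𝒳 × ℝ))
    [IsProbabilityMeasure P] (hY : ∀ᵐ p ∂P, p.2 ∈ Icc (0 : ℝ) 1) {f : 𝒳 → ℝ} (hf : Measurable f)
    {n : ℕ} (hn : 0 < n) (d : Fin n → 𝒳 × ℝ) (hd : ∀ i, (d i).2 ∈ Icc (0 : ℝ) 1)
    {w : 𝒳 × ℝ → ℝ} (hw : Measurable w) (hw1 : ∀ z, w z ∈ Icc (0 : ℝ) 1)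
    (hwY : ∀ z, z.2 ∈ Icc (0 : ℝ) 1 → w z = z.2) {B : ℝ}
    (hBw : ∀ q : ℚ, |(n : ℝ)⁻¹ * ∑ i, ((fun z => f z.1) ⁻¹' Iio (q : ℝ)).indicator w (d i)
      - ∫ z, ((fun z => f z.1) ⁻¹' Iio (q : ℝ)).indicator w z ∂P| ≤ B)
    (hB1 : ∀ q : ℚ, |(n : ℝ)⁻¹ * ∑ i, ((fun z => f z.1) ⁻¹' Iio (q : ℝ)).indicator 1 (d i)
      - ∫ z, ((fun z => f z.1) ⁻¹' Iio (q : ℝ)).indicator 1 z ∂P| ≤ B)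
    {h : ℝ → ℝ} (hh : Monotone h) (hh1 : ∀ x, h x ∈ Icc (0 : ℝ) 1) :
    cutoffCEP P (fun x => h (f x)) ≤ empCutoff (fun x => h (f x)) d + 4 * B := by
  have : Nonempty {I : Set ℝ // I ⊆ Icc 0 1 ∧ I.OrdConnected} :=
    ⟨∅, empty_subset _, ordConnected_empty⟩
  refine ciSup_le fun ⟨I, hI, hI'⟩ => ?_
  have key := abs_empirical_residual_sub_le P hn d (hf.comp measurable_fst) hw hw1 hBw hB1 hh hh1
    (hI'.preimage_mono hh)
  have hemp := le_empCutoff (fun x => h (f x)) d hI hI'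
  have hint : ∫ z, (w z - h (f z.1)) * (h ⁻¹' I).indicator 1 (f z.1) ∂P
      = ∫ z, (z.2 - h (f z.1)) * I.indicator (1 : ℝ → ℝ) (h (f z.1)) ∂P := by
    refine integral_congr_ae ?_
    filter_upwards [hY] with z hz
    rw [hwY z hz]
    rfl
  have hsum : ∑ i, (w (d i) - h (f (d i).1)) * (h ⁻¹' I).indicator 1 (f (d i).1)
      = ∑ i, ((d i).2 - h (f (d i).1)) * I.indicator (1 : ℝ → ℝ) (h (f (d i).1)) :=
    Finset.sum_congr rfl fun i _ => by rw [hwY _ (hd i)]; rfl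
  simp only [Function.comp_def] at key
  rw [hint, hsum] at key
  have h1 := abs_sub_abs_le_abs_sub
    (∫ z, (z.2 - h (f z.1)) * I.indicator (1 : ℝ → ℝ) (h (f z.1)) ∂P)
    ((n : ℝ)⁻¹ * ∑ i, ((d i).2 - h (f (d i).1)) * I.indicator (1 : ℝ → ℝ) (h (f (d i).1)))
  rw [abs_sub_comm] at key
  linarith

/-- Modified Platt scaling: given any monotone data-dependent post-processor `h̃_n`, let
`h_n = h̃_n` if the empirical cutoff calibration error of `h̃_n ∘ f` is at most `ε_n`, and
otherwise let `h_n` be the constant empirical mean of `Y`. Then with probability at least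
`1 − δ`, `Δ_Cutoff^P(h_n ∘ f) ≤ (30 + 2√(2·log(2/δ)))/√n + ε_n`. -/
theorem modified_platt_cutoff_bound {𝒳 : Type*} [MeasurableSpace 𝒳]
    (P : Measure (𝒳 × ℝ)) [IsProbabilityMeasure P]
    (hY : ∀ᵐ p ∂P, p.2 ∈ Icc (0:ℝ) 1)
    (f : 𝒳 → ℝ) (hf : Measurable f) (hf01 : ∀ x, f x ∈ Icc (0:ℝ) 1)
    (n : ℕ) (hn : 0 < n)
    (htil : (Fin n → 𝒳 × ℝ) → ℝ → ℝ)
    (htil_mono : ∀ d, Monotone (htil d))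
    (htil01 : ∀ d t, htil d t ∈ Icc (0:ℝ) 1)
    (ε : ℝ) (hε : 0 < ε) (δ : ℝ) (hδ : 0 < δ) :
    ENNReal.ofReal (1 - δ) ≤
      (Measure.pi fun _ : Fin n => P)
        {d | cutoffCEP P
            (if empCutoff (fun x => htil d (f x)) d ≤ ε
             then fun x => htil d (f x)
             else fun _ => (n : ℝ)⁻¹ * ∑ i, (d i).2)
          ≤ (30 + 2 * Real.sqrt (2 * Real.log (2/δ))) / Real.sqrt n + ε} := by
  rcases le_or_gt 1 δ with hδ1 | hδ1
  · rw [ENNReal.ofReal_of_nonpos (by linarith)]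
    exact zero_le
  set μ : Measure (Fin n → 𝒳 × ℝ) := Measure.pi fun _ => P with hμ
  set w : 𝒳 × ℝ → ℝ := fun z => max 0 (min z.2 1) with hw
  have mw : Measurable w := measurable_const.max (measurable_snd.min measurable_const)
  have w01 : ∀ z, w z ∈ Icc (0 : ℝ) 1 := fun z =>
    ⟨le_max_left _ _, max_le zero_le_one (min_le_right _ _)⟩
  have wY : ∀ z : 𝒳 × ℝ, z.2 ∈ Icc (0 : ℝ) 1 → w z = z.2 := fun z hz => by
    simp [hw, hz.1, hz.2]
  set φ : 𝒳 × ℝ → ℝ := fun z => f z.1 with hφ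
  have mφ : Measurable φ := hf.comp measurable_fst
  have hn' : (0 : ℝ) < n := by exact_mod_cast hn
  have hr : 0 < √(n : ℝ) := Real.sqrt_pos.2 hn'
  have hr2 : √(n : ℝ) * √n = n := Real.mul_self_sqrt hn'.le
  have hL : 0 ≤ Real.log (2 / δ) := Real.log_nonneg (by rw [le_div_iff₀ hδ]; linarith)
  set s : ℝ := √(2 * Real.log (2 / δ)) with hs
  have hs2 : s ^ 2 = 2 * Real.log (2 / δ) := Real.sq_sqrt (by positivity)
  have hs0 : 0 ≤ s := Real.sqrt_nonneg _
  set t : ℝ := s / (2 * √n) with ht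
  have ht0 : 0 ≤ t := by positivity
  have hexp : Real.exp (-2 * n * t ^ 2) = δ / 2 := by
    have : -2 * n * t ^ 2 = -Real.log (2 / δ) := by
      rw [ht, div_pow, hs2, mul_pow, sq √(n : ℝ), hr2]
      field_simp
    rw [this, Real.exp_neg, Real.exp_log (by positivity), inv_div]
  set B : ℝ := (n : ℝ)⁻¹ * (2 * (2 * √n)) + t with hB
  have h4B : 4 * B ≤ (30 + 2 * s) / √n := by
    have : 4 * B = (16 + 2 * s) / √n := by
      have hinv : (n : ℝ)⁻¹ * (2 * (2 * √n)) = 4 / √n := by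
        rw [eq_div_iff hr.ne', inv_mul_eq_div, div_mul_eq_mul_div, div_eq_iff hn'.ne']
        linear_combination 4 * hr2
      rw [hB, ht, hinv]
      field_simp
      ring
    rw [this]
    gcongr
    norm_num
  set bad : (𝒳 × ℝ → ℝ) → Set (Fin n → 𝒳 × ℝ) := fun v => {d | ∃ q : ℚ, B <
    |(n : ℝ)⁻¹ * ∑ i, (φ ⁻¹' Iio (q : ℝ)).indicator v (d i)
      - ∫ z, (φ ⁻¹' Iio (q : ℝ)).indicator v z ∂P|} with hbad
  have hbw : μ (bad w) ≤ ENNReal.ofReal (δ / 2) := by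
    rw [← hexp]
    exact measure_exists_threshold_gt_le P hn φ w mφ mw w01 t ht0
  have hb1 : μ (bad 1) ≤ ENNReal.ofReal (δ / 2) := by
    rw [← hexp]
    exact measure_exists_threshold_gt_le P hn φ 1 mφ measurable_one
      (fun z => ⟨zero_le_one, le_rfl⟩) t ht0
  set out : Set (Fin n → 𝒳 × ℝ) := {d | ¬ ∀ i, (d i).2 ∈ Icc (0 : ℝ) 1} with hout
  have hout0 : μ out = 0 := by
    have : ∀ᵐ d ∂μ, ∀ i, (d i).2 ∈ Icc (0 : ℝ) 1 :=
      ae_all_iff.2 fun i =>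
        (measurePreserving_eval (fun _ : Fin n => P) i).quasiMeasurePreserving.ae hY
    exact ae_iff.1 this
  set good : Set (Fin n → 𝒳 × ℝ) := {d | cutoffCEP P
            (if empCutoff (fun x => htil d (f x)) d ≤ ε
             then fun x => htil d (f x)
             else fun _ => (n : ℝ)⁻¹ * ∑ i, (d i).2)
          ≤ (30 + 2 * s) / √n + ε} with hgood
  have hcover : univ ⊆ good ∪ (bad w ∪ (bad 1 ∪ out)) := by
    intro d _
    by_contra hd
    simp only [mem_union, not_or] at hd
    obtain ⟨hg, hdw, hd1, hdo⟩ := hd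
    simp only [hbad, mem_ofPred_eq, not_exists, not_lt] at hdw hd1
    simp only [hout, mem_ofPred_eq, not_not] at hdo
    refine hg ?_
    simp only [hgood, mem_ofPred_eq]
    split_ifs with hcase
    · have := cutoffCEP_le_empCutoff_add P hY hf hn d hdo mw w01 wY hdw hd1 (htil_mono d)
        (htil01 d)
      linarith
    · have hmean : (n : ℝ)⁻¹ * ∑ i, (d i).2 ∈ Icc (0 : ℝ) 1 := by
        refine ⟨mul_nonneg (by positivity) (Finset.sum_nonneg fun i _ => (hdo i).1), ?_⟩
        rw [inv_mul_le_iff₀ hn']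
        exact (Finset.sum_le_sum fun i _ => (hdo i).2).trans (by simp)
      have := cutoffCEP_le_empCutoff_add P hY hf hn d hdo mw w01 wY hdw hd1
        (h := fun _ => (n : ℝ)⁻¹ * ∑ i, (d i).2) monotone_const fun _ => hmean
      linarith [empCutoff_mean_le hn d]
  have htotal : (1 : ENNReal) ≤ μ good + ENNReal.ofReal δ := by
    calc (1 : ENNReal) = μ univ := measure_univ.symm
      _ ≤ μ (good ∪ (bad w ∪ (bad 1 ∪ out))) := measure_mono hcover
      _ ≤ μ good + (μ (bad w) + (μ (bad 1) + μ out)) :=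
        (measure_union_le _ _).trans (add_le_add_right ((measure_union_le _ _).trans
          (add_le_add_right (measure_union_le _ _) _)) _)
      _ ≤ μ good + (ENNReal.ofReal (δ / 2) + (ENNReal.ofReal (δ / 2) + 0)) := by
        rw [hout0]; gcongr
      _ = μ good + ENNReal.ofReal δ := by
        rw [add_zero, ← ENNReal.ofReal_add (by positivity) (by positivity), add_halves]
  rw [ENNReal.ofReal_sub _ hδ.le, ENNReal.ofReal_one]
  exact tsub_le_iff_right.2 htotal
end
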